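/- arXiv:2405.20054 — 12 statements merged into one kernel-verified Lean document; each statement's English description precedes it below -/
import Mathlib

section
/- Let a < b be positive integers and consider the subtraction game on S = {a, b}. Set p = 2a if 2a divides a + b, and p = a + b otherwise. Then the outcome sequence is purely periodic with minimal period p: for all n ≥ 0, n + p is a P-position if and only if n is a P-position, and no smaller positive integer has this property. -/
/-- Nim-value (Sprague–Grundy value) of the subtraction game on `S`:
`subG S n = mex { subG S (n - s) : s ∈ S, s ≤ n }` (moves are positive). -/
noncomputable def subG (S : Finset ℕ) : ℕ → ℕ
  | n => sInf {k : ℕ | ∀ s ∈ S, ∀ (hs : 0 < s) (hn : s ≤ n), subG S (n - s) ≠ k}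
  decreasing_by exact Nat.sub_lt (Nat.lt_of_lt_of_le hs hn) hs

theorem subG_pair_eq_zero_iff {a b : ℕ} (ha : 0 < a) (hb : 0 < b) (n : ℕ) :
    subG {a, b} n = 0 ↔
      (a ≤ n → subG {a, b} (n - a) ≠ 0) ∧ (b ≤ n → subG {a, b} (n - b) ≠ 0) := by
  rw [subG, Nat.sInf_eq_zero]
  constructor
  · rintro (h | h)
    · exact ⟨fun h1 => h a (by simp) ha h1, fun h1 => h b (by simp) hb h1⟩
    · exfalso
      refine Set.eq_empty_iff_forall_notMem.mp h
        (subG {a, b} (n - a) + subG {a, b} (n - b) + 1) ?_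
      intro s hs _ _
      rcases Finset.mem_insert.mp hs with rfl | hs
      · omega
      · rw [Finset.mem_singleton.mp hs]
        omega
  · rintro ⟨h1, h2⟩
    left
    intro s hs _ hn
    rcases Finset.mem_insert.mp hs with rfl | hs
    · exact h1 hn
    · obtain rfl := Finset.mem_singleton.mp hs
      exact h2 hn

theorem Nat.add_mod_two_mul_lt_iff {a : ℕ} (ha : 0 < a) (m : ℕ) :
    (m + a) % (2 * a) < a ↔ a ≤ m % (2 * a) := by
  have h := Nat.mod_lt m (show 0 < 2 * a by omega)
  rw [Nat.add_mod_eq_ite, Nat.mod_eq_of_lt (show a < 2 * a by omega)]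
  split_ifs <;> omega

/-- The `P`-positions of the subtraction game on `{a, b}`. -/
theorem subG_pair_eq_zero_iff_mod {a b : ℕ} (ha : 0 < a) (hab : a < b) (n : ℕ) :
    subG {a, b} n = 0 ↔ n % (a + b) < b ∧ n % (a + b) % (2 * a) < a := by
  induction n using Nat.strong_induction_on with
  | _ n ih =>
  have hA : a ≤ n → _ := fun h => ih (n - a) (by omega)
  have hB : b ≤ n → _ := fun h => ih (n - b) (by omega)
  rw [subG_pair_eq_zero_iff ha (by omega)]
  have hm := Nat.mod_lt n (show 0 < a + b by omega)
  have hle := Nat.mod_le n (a + b)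
  have hdm := Nat.div_add_mod n (a + b)
  have hsmall : n % (a + b) = n ∨ a + b ≤ n := by
    rcases lt_or_ge n (a + b) with h | h
    · exact Or.inl (Nat.mod_eq_of_lt h)
    · exact Or.inr h
  generalize hmdef : n % (a + b) = m at *
  have sub_mod : ∀ x y, x < a + b → (y = x + (a + b) * (n / (a + b)) ∨
      y + (a + b) = x + (a + b) * (n / (a + b))) → y % (a + b) = x := by
    rintro x y hx (h | h)
    · rw [h, Nat.add_mul_mod_self_left, Nat.mod_eq_of_lt hx]
    · rw [← Nat.add_mod_right, h, Nat.add_mul_mod_self_left, Nat.mod_eq_of_lt hx]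
  generalize (a + b) * (n / (a + b)) = N at *
  have hflip := Nat.add_mod_two_mul_lt_iff ha
  rcases lt_or_ge m a with h1 | h1
  · have hR : m % (2 * a) = m := Nat.mod_eq_of_lt (by omega)
    have h2 : a ≤ n → subG {a, b} (n - a) ≠ 0 := by
      intro h
      rw [Ne, hA h, sub_mod (m + b) (n - a) (by omega) (by omega)]
      omega
    have h3 : b ≤ n → subG {a, b} (n - b) ≠ 0 := by
      intro h
      rw [Ne, hB h, sub_mod (m + a) (n - b) (by omega) (by omega), hflip]
      omega
    simp only [hR, h1, and_true]
    exact iff_of_true ⟨h2, h3⟩ (by omega)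
  have hA' := hA (by omega)
  rw [sub_mod (m - a) (n - a) (by omega) (by omega)] at hA'
  have hf := hflip (m - a)
  rw [Nat.sub_add_cancel h1] at hf
  rcases lt_or_ge m b with h2 | h2
  · have h3 : m % (2 * a) < a → b ≤ n → subG {a, b} (n - b) ≠ 0 := by
      intro hlt h
      rw [Ne, hB h, sub_mod (m + a) (n - b) (by omega) (by omega), hflip]
      omega
    constructor
    · rintro ⟨h4, -⟩
      have := h4 (by omega)
      rw [Ne, hA'] at this
      omega
    · rintro ⟨-, h4⟩
      refine ⟨fun _ => ?_, h3 h4⟩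
      rw [Ne, hA']
      omega
  · refine iff_of_false ?_ (by omega)
    rintro ⟨-, h4⟩
    refine h4 (by omega) ?_
    rw [hB (by omega), sub_mod (m - b) (n - b) (by omega) (by omega),
      Nat.mod_eq_of_lt (show m - b < 2 * a by omega)]
    omega

/-- two-move subtraction games `{a, b}` are purely periodic with
minimal outcome period `2a` if `2a ∣ a + b`, and `a + b` otherwise. -/
theorem two_move_outcome_period (a b p : ℕ) (ha : 0 < a) (hab : a < b)
    (hp : p = if 2 * a ∣ a + b then 2 * a else a + b) :
    (∀ n : ℕ, (subG {a, b} (n + p) = 0 ↔ subG {a, b} n = 0)) ∧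
    (∀ q : ℕ, 0 < q → (∀ n : ℕ, (subG {a, b} (n + q) = 0 ↔ subG {a, b} n = 0)) → p ≤ q) := by
  have hflip := Nat.add_mod_two_mul_lt_iff ha
  have hlow : ∀ n < a + b, (subG {a, b} n = 0 ↔ n < b ∧ n % (2 * a) < a) := fun n hn => by
    rw [subG_pair_eq_zero_iff_mod ha hab, Nat.mod_eq_of_lt hn]
  have hstart : ∀ n < 2 * a, (subG {a, b} n = 0 ↔ n < a) := fun n hn => by
    rw [hlow n (by omega), Nat.mod_eq_of_lt hn]
    omega
  constructor
  · intro n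
    split_ifs at hp with hd
    · have hmod : ∀ n, subG {a, b} n = 0 ↔ n % (2 * a) < a := fun n => by
        rw [subG_pair_eq_zero_iff_mod ha hab, Nat.mod_mod_of_dvd n hd, and_iff_right_iff_imp]
        intro h
        by_contra! hge
        have hlt := Nat.mod_lt n (show 0 < a + b by omega)
        have h1 : (n % (a + b) - b + (a + b)) % (2 * a) < a := by
          rw [Nat.add_mod, Nat.mod_eq_zero_of_dvd hd, Nat.add_zero, Nat.mod_mod,
            Nat.mod_eq_of_lt (by omega)]
          omega
        rw [show n % (a + b) - b + (a + b) = n % (a + b) + a by omega, hflip,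
          Nat.mod_mod_of_dvd n hd] at h1
        omega
      rw [hmod, hmod, hp, Nat.add_mod_right]
    · rw [subG_pair_eq_zero_iff_mod ha hab, subG_pair_eq_zero_iff_mod ha hab, hp,
        Nat.add_mod_right]
  · intro q hq hper
    by_contra! hlt
    have hp2 : p ≤ a + b := by split_ifs at hp <;> omega
    have hq0 := (hper 0).mpr ((hstart 0 (by omega)).mpr ha)
    rw [Nat.zero_add, hlow q (by omega)] at hq0
    obtain ⟨hqb, hqa⟩ := hq0
    have hdvd : 2 * a ∣ q := by
      by_contra hnd
      have hpos : 0 < q % (2 * a) := Nat.pos_of_ne_zero fun h => hnd (Nat.dvd_of_mod_eq_zero h)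
      have h1 := (hper (a - q % (2 * a))).mpr ((hstart _ (by omega)).mpr (by omega))
      have hle := Nat.mod_le q (2 * a)
      rw [hlow _ (by omega), show a - q % (2 * a) + q = q - q % (2 * a) + a by omega, hflip,
        Nat.mod_eq_zero_of_dvd (Nat.dvd_sub_mod q)] at h1
      omega
    have hq2 := Nat.le_of_dvd hq hdvd
    split_ifs at hp with hd
    · omega
    have hwin : ∀ i < a, a ≤ (b + i) % (2 * a) := fun i hi => by
      have h1 := hper (b + i - q)
      rw [Nat.sub_add_cancel (by omega), hlow _ (by omega), hlow _ (by omega)] at h1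
      have h2 : (b + i) % (2 * a) = (b + i - q) % (2 * a) := by
        conv_lhs => rw [← Nat.sub_add_cancel (show q ≤ b + i by omega)]
        rw [Nat.add_mod, Nat.mod_eq_zero_of_dvd hdvd, Nat.add_zero, Nat.mod_mod]
      omega
    have hb := hwin 0 ha
    rw [Nat.add_zero] at hb
    have hb2 := Nat.mod_lt b (show 0 < 2 * a by omega)
    have hsum : ∀ i, (b + i) % (2 * a) = (b % (2 * a) + i) % (2 * a) := fun i =>
      (Nat.mod_add_mod b (2 * a) i).symm
    have hba : b % (2 * a) = a := by
      by_contra hne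
      have h1 := hwin (2 * a - b % (2 * a)) (by omega)
      rw [hsum, show b % (2 * a) + (2 * a - b % (2 * a)) = 2 * a by omega, Nat.mod_self] at h1
      omega
    refine hd (Nat.dvd_of_mod_eq_zero ?_)
    rw [Nat.add_comm, hsum, hba, ← two_mul, Nat.mod_self]
end

section
/- (Austin's symmetric games.) Let S be a finite nonempty set of positive integers and let p be a positive integer such that for every s ∈ S, p − s ∈ S (in particular 0 < s < p for all s ∈ S). Then the nim-value sequence of the subtraction game on S is purely periodic with period p: G_S(n + p) = G_S(n) for all n ≥ 0. -/
/-- The set whose infimum is the nim-value is nonempty, as `S` is finite. -/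
theorem subG_admissible_nonempty (S : Finset ℕ) (n : ℕ) :
    {k : ℕ | ∀ s ∈ S, ∀ (_ : 0 < s) (_ : s ≤ n), subG S (n - s) ≠ k}.Nonempty := by
  obtain ⟨k, hk⟩ := Infinite.exists_notMem_finset (S.image fun s => subG S (n - s))
  exact ⟨k, fun s hs _ _ h => hk (Finset.mem_image.2 ⟨s, hs, h⟩)⟩

theorem subG_sub_ne {S : Finset ℕ} {n s : ℕ} (hs : s ∈ S) (h0 : 0 < s) (hn : s ≤ n) :
    subG S (n - s) ≠ subG S n := by
  have h := Nat.sInf_mem (subG_admissible_nonempty S n)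
  rw [← subG] at h
  exact h s hs h0 hn

theorem exists_subG_sub_eq_of_lt {S : Finset ℕ} {n k : ℕ} (hk : k < subG S n) :
    ∃ s ∈ S, 0 < s ∧ s ≤ n ∧ subG S (n - s) = k := by
  rw [subG] at hk
  have h := Nat.notMem_of_lt_sInf hk
  simp only [Set.mem_ofPred_eq] at h
  push Not at h
  obtain ⟨s, hs, h0, hn, h⟩ := h
  exact ⟨s, hs, h0, hn, h⟩

/-- Austin's symmetric games: if `p - s ∈ S` for every `s ∈ S`
(with `0 < s < p`), then the nim-value sequence is purely periodic with period `p`. -/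
theorem austin_symmetric (S : Finset ℕ) (hne : S.Nonempty) (hpos : ∀ s ∈ S, 0 < s)
    (p : ℕ) (hp : 0 < p) (hlt : ∀ s ∈ S, s < p) (hsym : ∀ s ∈ S, p - s ∈ S) :
    ∀ n : ℕ, subG S (n + p) = subG S n := by
  intro n
  induction n using Nat.strong_induction_on with
  | _ n ih =>
    apply le_antisymm
    · by_contra! hlt'
      obtain ⟨s, hs, _, _, h⟩ := exists_subG_sub_eq_of_lt hlt'
      have hsp := hlt s hs
      have hne' := subG_sub_ne (n := n + p - s) (hsym s hs) (by omega) (by omega)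
      rw [show n + p - s - (p - s) = n by omega] at hne'
      exact hne' h.symm
    · by_contra! hlt'
      obtain ⟨s, hs, h0, hn, h⟩ := exists_subG_sub_eq_of_lt hlt'
      have hne' := subG_sub_ne (n := n + p) hs h0 (by omega)
      rw [show n + p - s = n - s + p by omega, ih (n - s) (by omega)] at hne'
      exact hne' h
end

section
/- (Austin's adjoined moves.) Let S be a finite nonempty set of positive integers whose subtraction-game nim-value sequence is purely periodic with period p > 0, i.e. G_S(n + p) = G_S(n) for all n ≥ 0. If s ∈ S and p − s > 0, then adjoining the move p − s does not alter the nim-value sequence: G_{S ∪ {p − s}}(n) = G_S(n) for all n ≥ 0. -/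
theorem subG_mem (S : Finset ℕ) (n : ℕ) :
    subG S n ∈ {k : ℕ | ∀ s ∈ S, ∀ (_ : 0 < s) (_ : s ≤ n), subG S (n - s) ≠ k} := by
  rw [subG]
  apply Nat.sInf_mem
  obtain ⟨k, hk⟩ := Infinite.exists_notMem_finset (S.image fun s => subG S (n - s))
  exact ⟨k, fun s hs _ _ h => hk (Finset.mem_image.2 ⟨s, hs, h⟩)⟩

/-- Adjoining a move that never joins two positions of equal nim-value keeps all nim-values. -/
theorem subG_insert_eq {S : Finset ℕ} {t : ℕ}
    (ht : ∀ n, t ≤ n → subG S (n - t) ≠ subG S n) (n : ℕ) :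
    subG (insert t S) n = subG S n := by
  induction n using Nat.strong_induction_on with
  | _ n ih =>
    apply le_antisymm
    · rw [subG]
      refine Nat.sInf_le fun s hs h0 hn => ?_
      rw [ih (n - s) (by omega)]
      rcases Finset.mem_insert.1 hs with rfl | hs
      · exact ht n hn
      · exact subG_sub_ne hs h0 hn
    · conv_lhs => rw [subG]
      refine Nat.sInf_le fun s hs h0 hn => ?_
      rw [← ih (n - s) (by omega)]
      exact subG_sub_ne (Finset.mem_insert_of_mem hs) h0 hn

/-- Austin's adjoined moves: if the nim-value sequence of `S` is purely
periodic with period `p`, `s ∈ S` and `p - s > 0`, then adjoining the move `p - s`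
does not alter the nim-value sequence. -/
theorem austin_adjoin (S : Finset ℕ) (hne : S.Nonempty) (hpos : ∀ s ∈ S, 0 < s)
    (p : ℕ) (hp : 0 < p) (hper : ∀ n : ℕ, subG S (n + p) = subG S n)
    (s : ℕ) (hs : s ∈ S) (hps : 0 < p - s) :
    ∀ n : ℕ, subG (insert (p - s) S) n = subG S n := by
  refine subG_insert_eq fun n hn => ?_
  have h := subG_sub_ne (n := n + s) hs (hpos s hs) (Nat.le_add_left s n)
  rw [Nat.add_sub_cancel] at h
  rw [← hper, show n - (p - s) + p = n + s by omega]
  exact h.symm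
end

section
/- (Austin's two-move nim-sequences.) Let a, b, r, n be positive integers with 0 < r < a and consider the subtraction game on S = {a, b}. The nim-value sequence is purely periodic with period a + b, and writing m = x mod (a + b) for a position x: (i) if b = (2n − 1)a + r, then G_S(x) = ⌊m/a⌋ mod 2 when m < 2na, and G_S(x) = 2 when 2na ≤ m < a + b (so one period is the word (0^a 1^a)^n 2^r); (ii) if b = 2na + r, then G_S(x) = ⌊m/a⌋ mod 2 when m < 2na, G_S(x) = 0 when 2na ≤ m < 2na + r, G_S(x) = 2 when 2na + r ≤ m < (2n+1)a, and G_S(x) = 1 when (2n+1)a ≤ m < a + b (so one period is the word (0^a 1^a)^n 0^r 2^{a−r} 1^r). -/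
/-- The defining property of nim-values: a function that satisfies the mex conditions at every
position of the subtraction game on `{a, b}` is its nim-value function. -/
theorem subG_pair_eq_of_mex {a b : ℕ} (ha : 0 < a) (hb : 0 < b) (F : ℕ → ℕ)
    (hFa : ∀ x, F (x + a) ≠ F x) (hFb : ∀ x, F (x + b) ≠ F x)
    (hF : ∀ x, ∀ k < F x, (a ≤ x ∧ F (x - a) = k) ∨ (b ≤ x ∧ F (x - b) = k)) (x : ℕ) :
    subG {a, b} x = F x := by
  induction x using Nat.strong_induction_on with
  | _ x ih =>
    rw [subG]
    apply IsLeast.csInf_eq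
    constructor
    · intro s hs hs0 hsx
      rw [ih _ (by omega)]
      rcases Finset.mem_insert.1 hs with rfl | hs
      · have h := hFa (x - s)
        rw [Nat.sub_add_cancel hsx] at h
        exact h.symm
      · obtain rfl := Finset.mem_singleton.1 hs
        have h := hFb (x - s)
        rw [Nat.sub_add_cancel hsx] at h
        exact h.symm
    · intro k hk
      by_contra! hlt
      rcases hF x k hlt with ⟨hx, h⟩ | ⟨hx, h⟩
      · exact hk a (by simp) ha hx (by rw [ih _ (by omega), h])
      · exact hk b (by simp) hb hx (by rw [ih _ (by omega), h])

/-- To identify the nim-values of `{a, b}` with the `(a + b)`-periodic extension of `f`, it is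
enough to check the mex conditions within one period. -/
theorem subG_pair_eq_of_mex_period {a b : ℕ} (ha : 0 < a) (hb : 0 < b) (f : ℕ → ℕ)
    (hfa : ∀ m < b, f (m + a) ≠ f m) (hfb : ∀ m < a, f (m + b) ≠ f m)
    (hf : ∀ m < a + b, ∀ k < f m, (a ≤ m ∧ f (m - a) = k) ∨ (b ≤ m ∧ f (m - b) = k)) (x : ℕ) :
    subG {a, b} x = f (x % (a + b)) := by
  have hmod : ∀ m < a + b, ∀ q, (m + (a + b) * q) % (a + b) = m := fun m hm q => by
    rw [Nat.add_mul_mod_self_left, Nat.mod_eq_of_lt hm]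
  refine subG_pair_eq_of_mex ha hb (fun x => f (x % (a + b))) ?_ ?_ ?_ x <;> intro x <;>
    have hm := Nat.mod_lt x (show 0 < a + b by omega) <;>
    have hx := Nat.mod_add_div x (a + b) <;>
    generalize x % (a + b) = m at hm hx ⊢ <;>
    generalize x / (a + b) = q at hx <;> subst hx
  · rcases lt_or_ge m b with h | h
    · rw [show m + (a + b) * q + a = (m + a) + (a + b) * q by ring, hmod _ (by omega)]
      exact hfa m h
    · have hfm := hfb (m - b) (by omega)
      rw [Nat.sub_add_cancel h] at hfm
      rw [show m + (a + b) * q + a = (m - b) + (a + b) * (q + 1) by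
        rw [mul_add]; omega, hmod _ (by omega)]
      exact hfm.symm
  · rcases lt_or_ge m a with h | h
    · rw [show m + (a + b) * q + b = (m + b) + (a + b) * q by ring, hmod _ (by omega)]
      exact hfb m h
    · have hfm := hfa (m - a) (by omega)
      rw [Nat.sub_add_cancel h] at hfm
      rw [show m + (a + b) * q + b = (m - a) + (a + b) * (q + 1) by
        rw [mul_add]; omega, hmod _ (by omega)]
      exact hfm.symm
  · intro k hk
    rcases hf m hm k hk with ⟨h, hv⟩ | ⟨h, hv⟩
    · refine Or.inl ⟨by omega, ?_⟩
      rw [Nat.sub_add_comm h, hmod _ (by omega), hv]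
    · refine Or.inr ⟨by omega, ?_⟩
      rw [Nat.sub_add_comm h, hmod _ (by omega), hv]

/-- The parity of `m / a` on the last block of length `a` below `2 * n * a`. -/
theorem div_mod_two_eq_one {a n m : ℕ} (hn : 0 < n) (h₁ : 2 * n * a ≤ m + a)
    (h₂ : m < 2 * n * a) : m / a % 2 = 1 := by
  obtain ⟨k, rfl⟩ : ∃ k, n = k + 1 := ⟨n - 1, by omega⟩
  have h : m / a = 2 * k + 1 := Nat.div_eq_of_lt_le (by linarith) (by linarith)
  omega

theorem add_div_mod_two {a : ℕ} (ha : 0 < a) (m : ℕ) : (m + a) / a % 2 = 1 - m / a % 2 := by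
  rw [Nat.add_div_right m ha]
  omega

/-- If `b = (2n-1)a + r`, one period of nim-values is `(0^a 1^a)^n 2^r`. -/
theorem subG_pair_odd {a b r n : ℕ} (hr0 : 0 < r) (hra : r < a) (hn : 0 < n)
    (hb : a + b = 2 * n * a + r) (x : ℕ) :
    subG {a, b} x =
      if x % (a + b) < 2 * n * a then x % (a + b) / a % 2 else 2 := by
  have hstep := add_div_mod_two (a := a) (by omega)
  have hlast := fun m => div_mod_two_eq_one (a := a) (m := m) hn
  have hzero : ∀ m < a, m / a % 2 = 0 := fun m hm => by rw [Nat.div_eq_of_lt hm]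
  have hN : 2 * a ≤ 2 * n * a := Nat.mul_le_mul_right a (by omega)
  obtain ⟨g, hg⟩ : ∃ g : ℕ → ℕ, ∀ m, m / a % 2 = g m := ⟨_, fun _ => rfl⟩
  simp only [hg] at *
  generalize 2 * n * a = N at *
  refine subG_pair_eq_of_mex_period (by omega) (by omega)
    (fun m => if m < N then g m else 2) ?_ ?_ ?_ x
  · intro m hm
    have := hstep m
    have := hlast m
    split_ifs <;> omega
  · intro m hm
    have := hzero m hm
    have := hlast (m + b)
    split_ifs <;> omega
  · intro m hm k hk
    have hprev : a ≤ m → g m = 1 - g (m - a) := fun h => by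
      rw [← hstep, Nat.sub_add_cancel h]
    have := hzero m
    have := hzero (m - b)
    have := hlast (m - a)
    split_ifs at hk ⊢ <;> omega

/-- If `b = 2na + r`, one period of nim-values is `(0^a 1^a)^n 0^r 2^(a-r) 1^r`. -/
theorem subG_pair_even {a b r n : ℕ} (hr0 : 0 < r) (hra : r < a) (hn : 0 < n)
    (hb : b = 2 * n * a + r) (x : ℕ) :
    subG {a, b} x =
      if x % (a + b) < 2 * n * a then x % (a + b) / a % 2
      else if x % (a + b) < 2 * n * a + r then 0
      else if x % (a + b) < 2 * n * a + a then 2 else 1 := by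
  have hstep := add_div_mod_two (a := a) (by omega)
  have hlast := fun m => div_mod_two_eq_one (a := a) (m := m) hn
  have hzero : ∀ m < a, m / a % 2 = 0 := fun m hm => by rw [Nat.div_eq_of_lt hm]
  have hN : 2 * a ≤ 2 * n * a := Nat.mul_le_mul_right a (by omega)
  obtain ⟨g, hg⟩ : ∃ g : ℕ → ℕ, ∀ m, m / a % 2 = g m := ⟨_, fun _ => rfl⟩
  simp only [hg] at *
  generalize 2 * n * a = N at *
  refine subG_pair_eq_of_mex_period (by omega) (by omega)
    (fun m => if m < N then g m else if m < N + r then 0 else if m < N + a then 2 else 1)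
    ?_ ?_ ?_ x
  · intro m hm
    have := hstep m
    have := hlast m
    split_ifs <;> omega
  · intro m hm
    have := hzero m hm
    split_ifs <;> omega
  · intro m hm k hk
    have hprev : a ≤ m → g m = 1 - g (m - a) := fun h => by
      rw [← hstep, Nat.sub_add_cancel h]
    have := hzero m
    have := hzero (m - b)
    have := hlast (m - a)
    split_ifs at hk ⊢ <;> omega

/-- Austin's two-move nim-sequences: for `S = {a, b}` with
`b = (2n-1)a + r` or `b = 2na + r`, `0 < r < a`, the nim-value sequence is purely
periodic with period `a + b`, one period being `(0^a 1^a)^n 2^r`, respectively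
`(0^a 1^a)^n 0^r 2^(a-r) 1^r`. -/
theorem austin_two_move_nim_values (a b r n : ℕ) (ha : 0 < a) (hr0 : 0 < r) (hra : r < a)
    (hn : 0 < n) (hb : b = (2 * n - 1) * a + r ∨ b = 2 * n * a + r) :
    (∀ x : ℕ, subG {a, b} (x + (a + b)) = subG {a, b} x) ∧
    (b = (2 * n - 1) * a + r →
      ∀ x : ℕ,
        (x % (a + b) < 2 * n * a → subG {a, b} x = x % (a + b) / a % 2) ∧
        (2 * n * a ≤ x % (a + b) → subG {a, b} x = 2)) ∧
    (b = 2 * n * a + r →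
      ∀ x : ℕ,
        (x % (a + b) < 2 * n * a → subG {a, b} x = x % (a + b) / a % 2) ∧
        (2 * n * a ≤ x % (a + b) → x % (a + b) < 2 * n * a + r → subG {a, b} x = 0) ∧
        (2 * n * a + r ≤ x % (a + b) → x % (a + b) < (2 * n + 1) * a → subG {a, b} x = 2) ∧
        ((2 * n + 1) * a ≤ x % (a + b) → subG {a, b} x = 1)) := by
  have hsum : b = (2 * n - 1) * a + r → a + b = 2 * n * a + r := by
    obtain ⟨k, rfl⟩ : ∃ k, n = k + 1 := ⟨n - 1, by omega⟩
    rintro rfl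
    rw [show 2 * (k + 1) - 1 = 2 * k + 1 by omega]
    ring
  refine ⟨fun x => ?_, fun hb => ?_, fun hb => ?_⟩
  · have hmod : (x + (a + b)) % (a + b) = x % (a + b) := Nat.add_mod_right _ _
    rcases hb with hb | hb
    · have h := subG_pair_odd hr0 hra hn (hsum hb)
      rw [h, h, hmod]
    · have h := subG_pair_even hr0 hra hn hb
      rw [h, h, hmod]
  · intro x
    rw [subG_pair_odd hr0 hra hn (hsum hb)]
    constructor <;> intros <;> split_ifs <;> omega
  · intro x
    rw [subG_pair_even hr0 hra hn hb, add_mul, one_mul]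
    refine ⟨?_, ?_, ?_, ?_⟩ <;> intros <;> split_ifs <;> omega
end

section
/- (Flammenkamp, short periods.) Let S = {s_1 < s_2 < … < s_k} be a finite nonempty set of positive integers such that s_{i+1} − s_i ≤ s_1 for every 1 ≤ i < k. Then the outcome sequence of the subtraction game on S is purely periodic with period s_1 + s_k, consisting of s_1 P-positions followed by s_k N-positions: a position n is a P-position if and only if n mod (s_1 + s_k) < s_1. -/
/-- A position is a P-position exactly when no move leads to a P-position. -/
theorem subG_eq_zero_iff (S : Finset ℕ) (n : ℕ) :
    subG S n = 0 ↔ ∀ s ∈ S, 0 < s → s ≤ n → subG S (n - s) ≠ 0 := by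
  rw [subG, Nat.sInf_eq_zero]
  refine or_iff_left fun hempty => ?_
  obtain ⟨k, hk⟩ := Infinite.exists_notMem_finset (S.image fun s => subG S (n - s))
  have hmem : k ∈ {k : ℕ | ∀ s ∈ S, ∀ (_ : 0 < s) (_ : s ≤ n), subG S (n - s) ≠ k} :=
    fun s hs _ _ h => hk (Finset.mem_image.2 ⟨s, hs, h⟩)
  rw [hempty] at hmem
  exact hmem

/-- If the gaps of `S` are at most `a`, every `r` with `min S ≤ r < a + max S` lies less than `a`
above some element of `S`. -/
theorem exists_mem_le_lt_add_of_gap_le {S : Finset ℕ} (hne : S.Nonempty) {a r : ℕ}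
    (hgap : ∀ s ∈ S, s < S.max' hne → ∃ t ∈ S, s < t ∧ t ≤ s + a)
    (hmin : S.min' hne ≤ r) (hr : r < a + S.max' hne) : ∃ s ∈ S, s ≤ r ∧ r < s + a := by
  have hlow : (S.filter (· ≤ r)).Nonempty :=
    ⟨S.min' hne, Finset.mem_filter.2 ⟨S.min'_mem hne, hmin⟩⟩
  obtain ⟨hs, hsr⟩ := Finset.mem_filter.1 (Finset.max'_mem _ hlow)
  refine ⟨_, hs, hsr, ?_⟩
  rcases (S.le_max' _ hs).lt_or_eq with hlt | heq
  · obtain ⟨t, ht, hst, hta⟩ := hgap _ hs hlt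
    by_contra! hle
    have := (S.filter (· ≤ r)).le_max' t (Finset.mem_filter.2 ⟨ht, hta.trans hle⟩)
    omega
  · omega

/-- Flammenkamp, short periods: if each gap between consecutive elements
of `S` is at most `min S`, then the outcome sequence is purely periodic with period
`min S + max S`, consisting of `min S` P-positions followed by `max S` N-positions. -/
theorem flammenkamp_short_period (S : Finset ℕ) (hne : S.Nonempty) (hpos : ∀ s ∈ S, 0 < s)
    (hgap : ∀ s ∈ S, s < S.max' hne → ∃ t ∈ S, s < t ∧ t ≤ s + S.min' hne) :
    ∀ n : ℕ, subG S n = 0 ↔ n % (S.min' hne + S.max' hne) < S.min' hne := by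
  intro n
  have ha : 0 < S.min' hne := hpos _ (S.min'_mem hne)
  set p := S.min' hne + S.max' hne with hp
  induction n using Nat.strong_induction_on with
  | _ n ih =>
    have hrp : n % p < p := Nat.mod_lt _ (by omega)
    have hdiv : p * (n / p) + n % p = n := Nat.div_add_mod n p
    rw [subG_eq_zero_iff]
    constructor
    · intro h
      by_contra! hr
      obtain ⟨s, hs, hsr, hrs⟩ := exists_mem_le_lt_add_of_gap_le hne hgap hr hrp
      have hs0 := hpos s hs
      refine h s hs hs0 (by omega) ((ih (n - s) (by omega)).2 ?_)
      have hsub : n - s = (n % p - s) + p * (n / p) := by omega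
      rw [hsub, Nat.add_mul_mod_self_left, Nat.mod_eq_of_lt (by omega)]
      omega
    · intro hr s hs hs0 hsn h0
      have hlt := (ih (n - s) (by omega)).1 h0
      have hmin := S.min'_le s hs
      have hmax := S.le_max' s hs
      obtain ⟨q, hq⟩ : ∃ q, n / p = q + 1 := by
        refine Nat.exists_eq_succ_of_ne_zero fun h => ?_
        rw [h, mul_zero] at hdiv
        omega
      rw [hq, mul_add, mul_one] at hdiv
      have hsub : n - s = (n % p + p - s) + p * q := by omega
      rw [hsub, Nat.add_mul_mod_self_left, Nat.mod_eq_of_lt (by omega)] at hlt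
      omega
end

section
/- (Cairns–Ho.) Let S be a finite nonempty set of positive integers such that the outcome sequence of the subtraction game on S has ultimate period length two: there exists x such that for all n ≥ x, n + 2 is a P-position iff n is, and exactly one of n, n + 1 is a P-position. Then for all sufficiently large n, n is an N-position if and only if n is odd. -/
/-- When all moves are odd, the predecessor of an odd P-position is a P-position: the previous
player transfers the winning strategy by shifting every position down by one. -/
theorem subG_pred_eq_zero {S : Finset ℕ} (hodd : ∀ s ∈ S, Odd s) {n : ℕ}
    (hn : Odd n) (h : subG S n = 0) : subG S (n - 1) = 0 := by
  induction n using Nat.strong_induction_on with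
  | _ n ih =>
    rw [subG_eq_zero_iff] at h ⊢
    intro s hs hs0 hsn
    have hmove := h s hs hs0 (by omega)
    rw [Ne, subG_eq_zero_iff] at hmove ⊢
    push Not at hmove ⊢
    obtain ⟨t, ht, ht0, htn, hzero⟩ := hmove
    have hs1 := hodd s hs
    have ht1 := hodd t ht
    have hpar : Odd (n - s - t) := by
      rw [Nat.odd_iff] at *
      omega
    have hle : t ≤ n - 1 - s := by
      rw [Nat.odd_iff] at *
      omega
    refine ⟨t, ht, ht0, hle, ?_⟩
    have := ih (n - s - t) (by omega) hpar hzero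
    rwa [show n - 1 - s - t = n - s - t - 1 by omega]

theorem subG_add_two_mul_eq_zero_iff {S : Finset ℕ} {x : ℕ}
    (h : ∀ n, x ≤ n → (subG S (n + 2) = 0 ↔ subG S n = 0)) {n : ℕ} (hn : x ≤ n) (k : ℕ) :
    subG S (n + 2 * k) = 0 ↔ subG S n = 0 := by
  induction k with
  | zero => rfl
  | succ k ih => rw [← ih, ← h (n + 2 * k) (by omega)]; rfl

/-- Cairns–Ho: if the outcome sequence has ultimate period two, with
exactly one P-position among any two consecutive large positions, then for all
sufficiently large `n`, `n` is an N-position iff `n` is odd. -/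
theorem cairns_ho_ultimately_bipartite (S : Finset ℕ) (hne : S.Nonempty)
    (hpos : ∀ s ∈ S, 0 < s)
    (hper : ∃ x : ℕ, ∀ n : ℕ, x ≤ n →
      (subG S (n + 2) = 0 ↔ subG S n = 0) ∧ Xor' (subG S n = 0) (subG S (n + 1) = 0)) :
    ∃ N : ℕ, ∀ n : ℕ, N ≤ n → (subG S n ≠ 0 ↔ Odd n) := by
  obtain ⟨x, hx⟩ := hper
  have hodd : ∀ s ∈ S, Odd s := by
    intro s hs
    by_contra hs_even
    obtain ⟨k, hk⟩ := even_iff_two_dvd.1 (Nat.not_odd_iff_even.1 hs_even)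
    obtain ⟨n, hn, hzero⟩ : ∃ n, x ≤ n ∧ subG S n = 0 := by
      rcases (hx x le_rfl).2 with h | h
      · exact ⟨x, le_rfl, h.1⟩
      · exact ⟨x + 1, by omega, h.1⟩
    have hshift := (subG_add_two_mul_eq_zero_iff (fun n hn => (hx n hn).1) hn k).2 hzero
    refine (subG_eq_zero_iff S _).1 hshift s hs (hpos s hs) (by omega) ?_
    rwa [hk, Nat.add_sub_cancel]
  have hN : ∀ n, x < n → Odd n → subG S n ≠ 0 := by
    intro n hn hn_odd hzero
    have hxor := (hx (n - 1) (by omega)).2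
    rw [show n - 1 + 1 = n by omega] at hxor
    have hpred := subG_pred_eq_zero hodd hn_odd hzero
    rcases hxor with h | h
    · exact h.2 hzero
    · exact h.2 hpred
  refine ⟨x + 1, fun n hn => ⟨fun hne_zero => ?_, hN n hn⟩⟩
  by_contra hn_even
  rcases (hx n (by omega)).2 with h | h
  · exact hne_zero h.1
  · exact hN (n + 1) (by omega) (Nat.not_odd_iff_even.1 hn_even).add_one h.1
end

section
/- (Cairns–Ho, Theorem 2.) Each of the following families of subtraction games is ultimately bipartite, i.e. for all sufficiently large n the nim-values alternate: there exists N₀ such that G_S(n) = n mod 2 for all n ≥ N₀. The families are: (1) S = {2^j + 1 : 1 ≤ j ≤ k} = {3, 5, 9, …, 2^k + 1} for every integer k ≥ 3; (2) S = {3, 5, 2^k + 1} for every integer k ≥ 3; (3) S = {k, k + 2, 2k + 3} for every odd integer k ≥ 3. -/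
theorem subG_eq_of_mex {S : Finset ℕ} {f : ℕ → ℕ} (hpos : ∀ s ∈ S, 0 < s)
    (hne : ∀ s ∈ S, ∀ m, f (m + s) ≠ f m)
    (hex : ∀ n, ∀ j < f n, ∃ s ∈ S, ∃ m, m + s = n ∧ f m = j) (n : ℕ) : subG S n = f n := by
  induction n using Nat.strong_induction_on with
  | _ n ih =>
    have key : IsLeast {k : ℕ | ∀ s ∈ S, ∀ (hs : 0 < s) (hn : s ≤ n), subG S (n - s) ≠ k}
        (f n) := by
      constructor
      · intro s hs hs0 hn
        rw [ih _ (by omega)]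
        have h := hne s hs (n - s)
        rw [Nat.sub_add_cancel hn] at h
        exact h.symm
      · intro j hj
        by_contra! hlt
        obtain ⟨s, hs, m, rfl, hm⟩ := hex n j hlt
        refine hj s hs (hpos s hs) (by omega) ?_
        rw [Nat.add_sub_cancel, ih m (by have := hpos s hs; omega), hm]
    rw [subG]
    exact key.csInf_eq

/-- The nim-values of the game on `{3, 5, 8 * m + 1}` at the positions `8 * q + r`, `r < 8`. -/
def threeFiveValue (m q r : ℕ) : ℕ :=
  if q < m then [0, 0, 0, 1, 1, 1, 2, 2].getD r 0
  else if q = m then [0, 3, 3, 1, 0, 2, 0, 1].getD r 0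
  else if q < 2 * m then [0, 1, 3, 1, 0, 2, 0, 1].getD r 0
  else r % 2

theorem exists_threeFiveValue_eq {m q r j : ℕ} (hm : 1 ≤ m) (hr : r < 8)
    (hj : j < threeFiveValue m q r) :
    (3 ≤ r ∧ threeFiveValue m q (r - 3) = j) ∨
      (r < 3 ∧ 1 ≤ q ∧ threeFiveValue m (q - 1) (r + 5) = j) ∨
      (5 ≤ r ∧ threeFiveValue m q (r - 5) = j) ∨
      (r < 5 ∧ 1 ≤ q ∧ threeFiveValue m (q - 1) (r + 3) = j) ∨
      (1 ≤ r ∧ m ≤ q ∧ threeFiveValue m (q - m) (r - 1) = j) := by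
  unfold threeFiveValue at *
  interval_cases r <;> simp at hj ⊢ <;> grind

theorem threeFiveValue_ne {m q r q' r' : ℕ} (hm : 1 ≤ m) (hr : r < 8) (hr' : r' < 8)
    (h : 8 * q' + r' = 8 * q + r + 3 ∨ 8 * q' + r' = 8 * q + r + 5 ∨
      8 * q' + r' = 8 * q + r + (8 * m + 1)) :
    threeFiveValue m q' r' ≠ threeFiveValue m q r := by
  unfold threeFiveValue
  rcases h with h | h | h <;> interval_cases r <;>
  · obtain rfl | rfl | rfl | rfl | rfl | rfl | rfl | rfl :
        r' = 0 ∨ r' = 1 ∨ r' = 2 ∨ r' = 3 ∨ r' = 4 ∨ r' = 5 ∨ r' = 6 ∨ r' = 7 := by omega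
    all_goals first | (exfalso; omega) | (split_ifs <;> first | (exfalso; omega) | simp)

theorem subG_three_five {m : ℕ} (hm : 1 ≤ m) (n : ℕ) :
    subG {3, 5, 8 * m + 1} n = threeFiveValue m (n / 8) (n % 8) := by
  refine subG_eq_of_mex (f := fun n => threeFiveValue m (n / 8) (n % 8)) ?_ ?_ ?_ n
  · simp
  · intro s hs x
    simp only [Finset.mem_insert, Finset.mem_singleton] at hs
    exact threeFiveValue_ne hm (by omega) (by omega) (by omega)
  · intro n j hj
    have key {s q r : ℕ} (hs : s ∈ ({3, 5, 8 * m + 1} : Finset ℕ)) (hr : r < 8)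
        (hn : 8 * q + r + s = n) (hv : threeFiveValue m q r = j) :
        ∃ s ∈ ({3, 5, 8 * m + 1} : Finset ℕ), ∃ x, x + s = n ∧
          threeFiveValue m (x / 8) (x % 8) = j :=
      ⟨s, hs, 8 * q + r, hn, by
        rwa [show (8 * q + r) / 8 = q by omega, show (8 * q + r) % 8 = r by omega]⟩
    rcases exists_threeFiveValue_eq hm (by omega) hj with
      ⟨h, hv⟩ | ⟨h, h', hv⟩ | ⟨h, hv⟩ | ⟨h, h', hv⟩ | ⟨h, h', hv⟩
    · exact key (s := 3) (by simp) (by omega) (by omega) hv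
    · exact key (s := 3) (by simp) (by omega) (by omega) hv
    · exact key (s := 5) (by simp) (by omega) (by omega) hv
    · exact key (s := 5) (by simp) (by omega) (by omega) hv
    · exact key (s := 8 * m + 1) (by simp) (by omega) (by omega) hv

/-- The nim-values of the game on `{k, k + 2, 2 * k + 3}` at the positions
`(k + 1) * (3 * t) + r`, `r ≤ k`. -/
def oddRowZero (k t r : ℕ) : ℕ :=
  if r + 1 = 2 * t ∧ r + 2 ≤ k then 3 else if 2 * t ≤ r ∧ r < k then 0 else r % 2

/-- The nim-values of the game on `{k, k + 2, 2 * k + 3}` at the positions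
`(k + 1) * (3 * t + 1) + r`, `r ≤ k`. -/
def oddRowOne (k t r : ℕ) : ℕ :=
  if 2 * t ≤ r ∧ r + 2 ≤ k then 1
  else if (r + 1 = k ∧ 2 * t + 3 ≤ k) ∨ (r = k ∧ t = 0) then 2 else r % 2

/-- The nim-values of the game on `{k, k + 2, 2 * k + 3}` at the positions
`(k + 1) * (3 * t + 2) + r`, `r ≤ k`. -/
def oddRowTwo (k t r : ℕ) : ℕ :=
  if 2 * t + 3 ≤ k ∧ (r + 2 = k ∨ (r + 1 = k ∧ t = 0)) then 3
  else if 2 * t + 3 ≤ k ∧ (r + 1 = 2 * t ∨ (2 * t < r ∧ r < k)) then 2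
  else r % 2

/-- The nim-values of the game on `{k, k + 2, 2 * k + 3}` at the positions
`(k + 1) * h + r`, `r ≤ k`. -/
def oddValue (k h r : ℕ) : ℕ :=
  if h % 3 = 0 then oddRowZero k (h / 3) r
  else if h % 3 = 1 then oddRowOne k (h / 3) r
  else oddRowTwo k (h / 3) r

theorem oddValue_eq_oddRowZero {k h r : ℕ} (t : ℕ) (ht : h = 3 * t) :
    oddValue k h r = oddRowZero k t r := by
  rw [oddValue, if_pos (by omega), show h / 3 = t by omega]

theorem oddValue_eq_oddRowOne {k h r : ℕ} (t : ℕ) (ht : h = 3 * t + 1) :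
    oddValue k h r = oddRowOne k t r := by
  rw [oddValue, if_neg (by omega), if_pos (by omega), show h / 3 = t by omega]

theorem oddValue_eq_oddRowTwo {k h r : ℕ} (t : ℕ) (ht : h = 3 * t + 2) :
    oddValue k h r = oddRowTwo k t r := by
  rw [oddValue, if_neg (by omega), if_neg (by omega), show h / 3 = t by omega]

theorem exists_eq_three_mul_add (h : ℕ) : ∃ t, h = 3 * t ∨ h = 3 * t + 1 ∨ h = 3 * t + 2 :=
  ⟨h / 3, by omega⟩

theorem oddValue_zero_right {k h : ℕ} (hk : 5 ≤ k) (hodd : k % 2 = 1) :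
    oddValue k h k ≠ oddValue k h 0 := by
  obtain ⟨t, ht | ht | ht⟩ := exists_eq_three_mul_add h
  · rw [oddValue_eq_oddRowZero t ht, oddValue_eq_oddRowZero t ht]
    unfold oddRowZero
    split_ifs <;> omega
  · rw [oddValue_eq_oddRowOne t ht, oddValue_eq_oddRowOne t ht]
    unfold oddRowOne
    split_ifs <;> omega
  · rw [oddValue_eq_oddRowTwo t ht, oddValue_eq_oddRowTwo t ht]
    unfold oddRowTwo
    split_ifs <;> omega

theorem oddValue_succ_left {k h r : ℕ} (hk : 5 ≤ k) (hodd : k % 2 = 1) (hr : r < k) :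
    oddValue k (h + 1) r ≠ oddValue k h (r + 1) := by
  obtain ⟨t, ht | ht | ht⟩ := exists_eq_three_mul_add h
  · rw [oddValue_eq_oddRowZero t ht, oddValue_eq_oddRowOne t (by omega)]
    unfold oddRowZero oddRowOne
    split_ifs <;> omega
  · rw [oddValue_eq_oddRowOne t ht, oddValue_eq_oddRowTwo t (by omega)]
    unfold oddRowOne oddRowTwo
    split_ifs <;> omega
  · rw [oddValue_eq_oddRowTwo t ht, oddValue_eq_oddRowZero (t + 1) (by omega)]
    unfold oddRowTwo oddRowZero
    split_ifs <;> omega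

theorem oddValue_succ_succ {k h r : ℕ} (hodd : k % 2 = 1) (hr : r < k) :
    oddValue k (h + 1) (r + 1) ≠ oddValue k h r := by
  obtain ⟨t, ht | ht | ht⟩ := exists_eq_three_mul_add h
  · rw [oddValue_eq_oddRowZero t ht, oddValue_eq_oddRowOne t (by omega)]
    unfold oddRowZero oddRowOne
    split_ifs <;> omega
  · rw [oddValue_eq_oddRowOne t ht, oddValue_eq_oddRowTwo t (by omega)]
    unfold oddRowOne oddRowTwo
    split_ifs <;> omega
  · rw [oddValue_eq_oddRowTwo t ht, oddValue_eq_oddRowZero (t + 1) (by omega)]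
    unfold oddRowTwo oddRowZero
    split_ifs <;> omega

theorem oddValue_add_two_zero {k h : ℕ} (hodd : k % 2 = 1) :
    oddValue k (h + 2) 0 ≠ oddValue k h k := by
  obtain ⟨t, ht | ht | ht⟩ := exists_eq_three_mul_add h
  · rw [oddValue_eq_oddRowZero t ht, oddValue_eq_oddRowTwo t (by omega)]
    unfold oddRowZero oddRowTwo
    split_ifs <;> omega
  · rw [oddValue_eq_oddRowOne t ht, oddValue_eq_oddRowZero (t + 1) (by omega)]
    unfold oddRowOne oddRowZero
    split_ifs <;> omega
  · rw [oddValue_eq_oddRowTwo t ht, oddValue_eq_oddRowOne (t + 1) (by omega)]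
    unfold oddRowTwo oddRowOne
    split_ifs <;> omega

theorem oddValue_add_two_succ {k h r : ℕ} (hodd : k % 2 = 1) (hr : r < k) :
    oddValue k (h + 2) (r + 1) ≠ oddValue k h r := by
  obtain ⟨t, ht | ht | ht⟩ := exists_eq_three_mul_add h
  · rw [oddValue_eq_oddRowZero t ht, oddValue_eq_oddRowTwo t (by omega)]
    unfold oddRowZero oddRowTwo
    split_ifs <;> omega
  · rw [oddValue_eq_oddRowOne t ht, oddValue_eq_oddRowZero (t + 1) (by omega)]
    unfold oddRowOne oddRowZero
    split_ifs <;> omega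
  · rw [oddValue_eq_oddRowTwo t ht, oddValue_eq_oddRowOne (t + 1) (by omega)]
    unfold oddRowTwo oddRowOne
    split_ifs <;> grind

theorem oddValue_add_three_zero {k h : ℕ} (hk : 5 ≤ k) (hodd : k % 2 = 1) :
    oddValue k (h + 3) 0 ≠ oddValue k h k := by
  obtain ⟨t, ht | ht | ht⟩ := exists_eq_three_mul_add h
  · rw [oddValue_eq_oddRowZero t ht, oddValue_eq_oddRowZero (t + 1) (by omega)]
    unfold oddRowZero
    split_ifs <;> omega
  · rw [oddValue_eq_oddRowOne t ht, oddValue_eq_oddRowOne (t + 1) (by omega)]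
    unfold oddRowOne
    split_ifs <;> omega
  · rw [oddValue_eq_oddRowTwo t ht, oddValue_eq_oddRowTwo (t + 1) (by omega)]
    unfold oddRowTwo
    split_ifs <;> omega

theorem exists_oddValue_eq {k h r j : ℕ} (hk : 5 ≤ k) (hodd : k % 2 = 1) (hr : r ≤ k)
    (hj : j < oddValue k h r) :
    (r < k ∧ 1 ≤ h ∧ oddValue k (h - 1) (r + 1) = j) ∨ (r = k ∧ oddValue k h 0 = j) ∨
      (1 ≤ r ∧ 1 ≤ h ∧ oddValue k (h - 1) (r - 1) = j) ∨
      (1 ≤ r ∧ 2 ≤ h ∧ oddValue k (h - 2) (r - 1) = j) := by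
  have h_edge := Nat.lt_or_ge r k
  obtain ⟨t, ht | ht | ht⟩ := exists_eq_three_mul_add h
  · rw [oddValue_eq_oddRowZero t ht] at hj
    rw [oddValue_eq_oddRowZero t ht]
    rcases Nat.eq_zero_or_pos t with rfl | hpos
    · unfold oddRowZero at *
      obtain rfl : r = k := by grind
      refine Or.inr (Or.inl ⟨rfl, ?_⟩)
      grind
    · rw [oddValue_eq_oddRowTwo (t - 1) (by omega),
        oddValue_eq_oddRowTwo (t - 1) (by omega), oddValue_eq_oddRowOne (t - 1) (by omega)]
      rcases h_edge with h_edge | h_edge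
      all_goals
        unfold oddRowZero at hj
        split_ifs at hj <;>
        obtain rfl | rfl | rfl : j = 0 ∨ j = 1 ∨ j = 2 := by omega
        all_goals
          first
          | exfalso; omega
          | (refine Or.inl ⟨by omega, by omega, ?_⟩; unfold oddRowTwo; split_ifs <;> omega)
          | (refine Or.inr (Or.inl ⟨by omega, ?_⟩); unfold oddRowZero; split_ifs <;> omega)
          | (refine Or.inr (Or.inr (Or.inl ⟨by omega, by omega, ?_⟩)); unfold oddRowTwo; split_ifs <;> omega)
          | (refine Or.inr (Or.inr (Or.inr ⟨by omega, by omega, ?_⟩)); unfold oddRowOne; split_ifs <;> omega)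
  · rw [oddValue_eq_oddRowOne t ht] at hj
    rw [oddValue_eq_oddRowOne t ht, oddValue_eq_oddRowZero t (by omega),
      oddValue_eq_oddRowZero t (by omega)]
    rcases h_edge with h_edge | h_edge
    all_goals
      unfold oddRowOne at hj
      split_ifs at hj <;>
      obtain rfl | rfl | rfl : j = 0 ∨ j = 1 ∨ j = 2 := by omega
      all_goals
        first
        | exfalso; omega
        | (refine Or.inl ⟨by omega, by omega, ?_⟩; unfold oddRowZero; split_ifs <;> omega)
        | (refine Or.inr (Or.inl ⟨by omega, ?_⟩); unfold oddRowOne; split_ifs <;> omega)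
        | (refine Or.inr (Or.inr (Or.inl ⟨by omega, by omega, ?_⟩)); unfold oddRowZero; split_ifs <;> omega)
  · rw [oddValue_eq_oddRowTwo t ht] at hj
    rw [oddValue_eq_oddRowTwo t ht, oddValue_eq_oddRowOne t (by omega),
      oddValue_eq_oddRowOne t (by omega), oddValue_eq_oddRowZero t (by omega)]
    rcases h_edge with h_edge | h_edge
    all_goals
      unfold oddRowTwo at hj
      split_ifs at hj <;>
      obtain rfl | rfl | rfl : j = 0 ∨ j = 1 ∨ j = 2 := by omega
      all_goals
        first
        | exfalso; omega
        | (refine Or.inl ⟨by omega, by omega, ?_⟩; unfold oddRowOne; split_ifs <;> omega)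
        | (refine Or.inr (Or.inl ⟨by omega, ?_⟩); unfold oddRowTwo; split_ifs <;> omega)
        | (refine Or.inr (Or.inr (Or.inl ⟨by omega, by omega, ?_⟩)); unfold oddRowOne; split_ifs <;> omega)
        | (refine Or.inr (Or.inr (Or.inr ⟨by omega, by omega, ?_⟩)); unfold oddRowZero; split_ifs <;> omega)

theorem oddValue_eq_mod_two {k h r : ℕ} (hodd : k % 2 = 1) (hh : 3 * k ≤ h) :
    oddValue k h r = r % 2 := by
  obtain ⟨t, ht | ht | ht⟩ := exists_eq_three_mul_add h
  · rw [oddValue_eq_oddRowZero t ht]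
    unfold oddRowZero
    split_ifs <;> omega
  · rw [oddValue_eq_oddRowOne t ht]
    unfold oddRowOne
    split_ifs <;> omega
  · rw [oddValue_eq_oddRowTwo t ht]
    unfold oddRowTwo
    split_ifs <;> omega

theorem subG_odd {k : ℕ} (hk : 5 ≤ k) (hodd : k % 2 = 1) (n : ℕ) :
    subG {k, k + 2, 2 * k + 3} n = oddValue k (n / (k + 1)) (n % (k + 1)) := by
  have hdiv {h r : ℕ} (hr : r ≤ k) : ((k + 1) * h + r) / (k + 1) = h := by
    rw [Nat.mul_add_div (by omega), Nat.div_eq_of_lt (by omega), add_zero]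
  have hmod {h r : ℕ} (hr : r ≤ k) : ((k + 1) * h + r) % (k + 1) = r := by
    rw [Nat.mul_add_mod, Nat.mod_eq_of_lt (by omega)]
  have hpos (n : ℕ) : ∃ h r, r ≤ k ∧ n = (k + 1) * h + r :=
    ⟨n / (k + 1), n % (k + 1), Nat.le_of_lt_succ (Nat.mod_lt _ (by omega)),
      (Nat.div_add_mod n (k + 1)).symm⟩
  refine subG_eq_of_mex (f := fun n => oddValue k (n / (k + 1)) (n % (k + 1))) ?_ ?_ ?_ n
  · simp only [Finset.mem_insert, Finset.mem_singleton]
    omega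
  · intro s hs x
    obtain ⟨h, r, hr, rfl⟩ := hpos x
    have key {h' r' : ℕ} (hr' : r' ≤ k) (hx : (k + 1) * h + r + s = (k + 1) * h' + r')
        (hv : oddValue k h' r' ≠ oddValue k h r) :
        oddValue k (((k + 1) * h + r + s) / (k + 1)) (((k + 1) * h + r + s) % (k + 1)) ≠
          oddValue k (((k + 1) * h + r) / (k + 1)) (((k + 1) * h + r) % (k + 1)) := by
      rwa [hx, hdiv hr', hmod hr', hdiv hr, hmod hr]
    simp only [Finset.mem_insert, Finset.mem_singleton] at hs
    rcases hs with rfl | rfl | rfl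
    · rcases Nat.eq_zero_or_pos r with rfl | h0
      · exact key (h' := h) le_rfl (by ring) (oddValue_zero_right hk hodd)
      · obtain ⟨r, rfl⟩ := Nat.exists_eq_add_of_le' h0
        exact key (h' := h + 1) (r' := r) (by omega) (by ring)
          (oddValue_succ_left hk hodd (by omega))
    · rcases hr.lt_or_eq with hlt | rfl
      · exact key (h' := h + 1) (r' := r + 1) hlt (by ring) (oddValue_succ_succ hodd hlt)
      · exact key (h' := h + 2) (r' := 0) (by omega) (by ring) (oddValue_add_two_zero hodd)
    · rcases hr.lt_or_eq with hlt | rfl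
      · exact key (h' := h + 2) (r' := r + 1) hlt (by ring) (oddValue_add_two_succ hodd hlt)
      · exact key (h' := h + 3) (r' := 0) (by omega) (by ring) (oddValue_add_three_zero hk hodd)
  · intro n j hj
    obtain ⟨h, r, hr, rfl⟩ := hpos n
    rw [hdiv hr, hmod hr] at hj
    have key {s h' r' : ℕ} (hs : s ∈ ({k, k + 2, 2 * k + 3} : Finset ℕ)) (hr' : r' ≤ k)
        (hn : (k + 1) * h' + r' + s = (k + 1) * h + r) (hv : oddValue k h' r' = j) :
        ∃ s ∈ ({k, k + 2, 2 * k + 3} : Finset ℕ), ∃ x, x + s = (k + 1) * h + r ∧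
          oddValue k (x / (k + 1)) (x % (k + 1)) = j :=
      ⟨s, hs, (k + 1) * h' + r', hn, by rwa [hdiv hr', hmod hr']⟩
    rcases exists_oddValue_eq hk hodd hr hj with
      ⟨h1, h2, hv⟩ | ⟨rfl, hv⟩ | ⟨h1, h2, hv⟩ | ⟨h1, h2, hv⟩
    · obtain ⟨h, rfl⟩ := Nat.exists_eq_add_of_le' h2
      exact key (s := k) (h' := h) (r' := r + 1) (by simp) h1 (by ring) hv
    · exact key (s := r) (by simp) (Nat.zero_le _) (by ring) hv
    · obtain ⟨h, rfl⟩ := Nat.exists_eq_add_of_le' h2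
      obtain ⟨r, rfl⟩ := Nat.exists_eq_add_of_le' h1
      exact key (s := k + 2) (h' := h) (r' := r) (by simp) (by omega) (by ring) hv
    · obtain ⟨h, rfl⟩ := Nat.exists_eq_add_of_le' h2
      obtain ⟨r, rfl⟩ := Nat.exists_eq_add_of_le' h1
      exact key (s := 2 * k + 3) (h' := h) (r' := r) (by simp) (by omega) (by ring) hv

open Classical in
/-- The nim-values of the game on `{2 ^ j + 1 : 1 ≤ j ≤ k}`. -/
noncomputable def powValue (k n : ℕ) : ℕ :=
  if n < 32 then
    [0, 0, 0, 1, 1, 1, 2, 2, 0, 3, 3, 1, 0, 2, 0, 1,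
      0, 1, 4, 1, 0, 2, 0, 1, 0, 1, 0, 1, 0, 1, 0, 1].getD n 0
  else if ∃ i ≤ k, n = 2 ^ i + 2 then 2
  else if ∃ i ≤ k, n = 2 ^ i + 5 then 3
  else n % 2

theorem two_pow_eq_or_dvd (j : ℕ) :
    2 ^ j = 1 ∨ 2 ^ j = 2 ∨ 2 ^ j = 4 ∨ 2 ^ j = 8 ∨ 2 ^ j = 16 ∨ 32 ∣ 2 ^ j := by
  rcases lt_or_ge j 5 with h | h
  · interval_cases j <;> simp
  · exact Or.inr (Or.inr (Or.inr (Or.inr (Or.inr (pow_dvd_pow 2 h)))))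

theorem powValue_of_lt {n : ℕ} (k : ℕ) (hn : n < 32) :
    powValue k n = [0, 0, 0, 1, 1, 1, 2, 2, 0, 3, 3, 1, 0, 2, 0, 1,
      0, 1, 4, 1, 0, 2, 0, 1, 0, 1, 0, 1, 0, 1, 0, 1].getD n 0 := if_pos hn

theorem powValue_two_pow_add_two {k i : ℕ} (hi : 32 ≤ 2 ^ i + 2) (hik : i ≤ k) :
    powValue k (2 ^ i + 2) = 2 := by
  rw [powValue, if_neg hi.not_gt, if_pos ⟨i, hik, rfl⟩]

theorem powValue_two_pow_add_five {k i : ℕ} (hi : 32 ≤ 2 ^ i + 5) (hik : i ≤ k) :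
    powValue k (2 ^ i + 5) = 3 := by
  rw [powValue, if_neg hi.not_gt, if_neg, if_pos ⟨i, hik, rfl⟩]
  rintro ⟨l, -, hl⟩
  have := two_pow_eq_or_dvd i
  have := two_pow_eq_or_dvd l
  omega

theorem powValue_of_forall_ne {k n : ℕ} (hn : 32 ≤ n) (h2 : ∀ i ≤ k, n ≠ 2 ^ i + 2)
    (h5 : ∀ i ≤ k, n ≠ 2 ^ i + 5) : powValue k n = n % 2 := by
  rw [powValue, if_neg hn.not_gt, if_neg (by simpa using h2), if_neg (by simpa using h5)]

theorem powValue_cases {k n : ℕ} (hn : 32 ≤ n) :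
    (∃ i ≤ k, n = 2 ^ i + 2 ∧ powValue k n = 2) ∨ (∃ i ≤ k, n = 2 ^ i + 5 ∧ powValue k n = 3) ∨
      ((∀ i ≤ k, n ≠ 2 ^ i + 2) ∧ (∀ i ≤ k, n ≠ 2 ^ i + 5) ∧ powValue k n = n % 2) := by
  by_cases h2 : ∃ i ≤ k, n = 2 ^ i + 2
  · obtain ⟨i, hi, rfl⟩ := h2
    exact Or.inl ⟨i, hi, rfl, powValue_two_pow_add_two hn hi⟩
  by_cases h5 : ∃ i ≤ k, n = 2 ^ i + 5
  · obtain ⟨i, hi, rfl⟩ := h5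
    exact Or.inr (Or.inl ⟨i, hi, rfl, powValue_two_pow_add_five hn hi⟩)
  push Not at h2 h5
  exact Or.inr (Or.inr ⟨h2, h5, powValue_of_forall_ne hn h2 h5⟩)

theorem eq_of_powValue_odd {k n : ℕ} (hn : n % 2 = 1) :
    (powValue k n = 0 → n = 1) ∧ (powValue k n = 2 → n = 7 ∨ n = 13 ∨ n = 21) := by
  rcases lt_or_ge n 32 with h | h
  · rw [powValue_of_lt k h]
    interval_cases n <;> revert hn <;> decide
  · rcases powValue_cases (k := k) h with ⟨i, -, rfl, hv⟩ | ⟨i, -, rfl, hv⟩ | ⟨-, -, hv⟩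
    · have := two_pow_eq_or_dvd i
      omega
    · omega
    · omega

theorem eq_of_powValue_even {k n : ℕ} (hn : n % 2 = 0) :
    (powValue k n = 1 → n = 4) ∧ (powValue k n = 3 → n = 10) := by
  rcases lt_or_ge n 32 with h | h
  · rw [powValue_of_lt k h]
    interval_cases n <;> revert hn <;> decide
  · rcases powValue_cases (k := k) h with ⟨i, -, rfl, hv⟩ | ⟨i, -, rfl, hv⟩ | ⟨-, -, hv⟩
    · omega
    · have := two_pow_eq_or_dvd i
      omega
    · omega

theorem powValue_add_ne {k j : ℕ} (m : ℕ) (hj : 1 ≤ j) (hjk : j ≤ k) :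
    powValue k (m + (2 ^ j + 1)) ≠ powValue k m := by
  have h2 := (Nat.pow_le_pow_right two_pos hj : 2 ^ 1 ≤ 2 ^ j)
  have hd := two_pow_eq_or_dvd j
  rcases lt_or_ge (m + (2 ^ j + 1)) 32 with h | h
  · rw [powValue_of_lt k h, powValue_of_lt k (by omega)]
    have key : ∀ s ∈ [3, 5, 9, 17], ∀ m, m + s < 32 →
        [0, 0, 0, 1, 1, 1, 2, 2, 0, 3, 3, 1, 0, 2, 0, 1,
          0, 1, 4, 1, 0, 2, 0, 1, 0, 1, 0, 1, 0, 1, 0, 1].getD (m + s) 0 ≠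
        [0, 0, 0, 1, 1, 1, 2, 2, 0, 3, 3, 1, 0, 2, 0, 1,
          0, 1, 4, 1, 0, 2, 0, 1, 0, 1, 0, 1, 0, 1, 0, 1].getD m 0 := by
      intro s hs m hm
      have : m < 32 := by omega
      revert s
      interval_cases m <;> decide
    exact key _ (by simp only [List.mem_cons, List.not_mem_nil]; omega) m h
  · intro heq
    rcases Nat.mod_two_eq_zero_or_one m with hm | hm
    · have hm' := eq_of_powValue_even (k := k) hm
      rcases powValue_cases (k := k) h with ⟨i, -, hi, hv⟩ | ⟨i, -, hi, hv⟩ | ⟨-, h5, hv⟩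
      · have := two_pow_eq_or_dvd i
        omega
      · have := two_pow_eq_or_dvd i
        omega
      · have := h5 j hjk
        omega
    · have hm' := eq_of_powValue_odd (k := k) hm
      rcases powValue_cases (k := k) h with ⟨i, -, hi, hv⟩ | ⟨i, -, hi, hv⟩ | ⟨h2, -, hv⟩
      · have := two_pow_eq_or_dvd i
        omega
      · have := two_pow_eq_or_dvd i
        omega
      · have := h2 j hjk
        omega

theorem powValue_eq_mod_two {k n : ℕ} (hn : 16 ≤ n) (h18 : n ≠ 18) (h21 : n ≠ 21)
    (h2 : ∀ i, n ≠ 2 ^ i + 2) (h5 : ∀ i, n ≠ 2 ^ i + 5) : powValue k n = n % 2 := by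
  rcases lt_or_ge n 32 with h | h
  · rw [powValue_of_lt k h]
    interval_cases n <;> simp at *
  · exact powValue_of_forall_ne h (fun i _ => h2 i) (fun i _ => h5 i)

theorem exists_powValue_eq {k n v : ℕ} (hk : 4 ≤ k) (hv : v < powValue k n) :
    ∃ j m, 1 ≤ j ∧ j ≤ k ∧ m + (2 ^ j + 1) = n ∧ powValue k m = v := by
  rcases lt_or_ge n 32 with h | h
  · rw [powValue_of_lt k h] at hv
    have key : ∀ n < 32, ∀ v < [0, 0, 0, 1, 1, 1, 2, 2, 0, 3, 3, 1, 0, 2, 0, 1,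
          0, 1, 4, 1, 0, 2, 0, 1, 0, 1, 0, 1, 0, 1, 0, 1].getD n 0,
        ∃ j < 5, 1 ≤ j ∧ 2 ^ j + 1 ≤ n ∧ [0, 0, 0, 1, 1, 1, 2, 2, 0, 3, 3, 1, 0, 2, 0, 1,
          0, 1, 4, 1, 0, 2, 0, 1, 0, 1, 0, 1, 0, 1, 0, 1].getD (n - (2 ^ j + 1)) 0 = v := by
      decide
    obtain ⟨j, hj, hj1, hle, hval⟩ := key n h v hv
    exact ⟨j, n - (2 ^ j + 1), hj1, by omega, by omega, by
      rwa [powValue_of_lt k ((Nat.sub_le _ _).trans_lt h)]⟩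
  rcases powValue_cases (k := k) h with ⟨i, hi, rfl, hn⟩ | ⟨i, hi, rfl, hn⟩ | ⟨h2, h5, hn⟩
  · have hi' : 5 ≤ i := by
      by_contra! hlt
      interval_cases i <;> omega
    obtain ⟨i, rfl⟩ := Nat.exists_eq_add_of_le' hi'
    have hpow : 2 ^ (i + 5) = 2 * 2 ^ (i + 4) := by ring
    obtain rfl | rfl : v = 0 ∨ v = 1 := by omega
    · exact ⟨i + 5, 1, by omega, hi, by ring, by simp [powValue_of_lt]⟩
    · refine ⟨i + 4, 2 ^ (i + 4) + 1, by omega, by omega, by omega, ?_⟩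
      have hd := two_pow_eq_or_dvd (i + 4)
      rw [powValue_eq_mod_two (by omega) (by omega) (by omega)]
      · omega
      all_goals
        intro l
        have := two_pow_eq_or_dvd l
        omega
  · have hi' : 5 ≤ i := by
      by_contra! hlt
      interval_cases i <;> omega
    obtain ⟨i, rfl⟩ := Nat.exists_eq_add_of_le' hi'
    have hpow : 2 ^ (i + 5) = 2 * 2 ^ (i + 4) := by ring
    obtain rfl | rfl | rfl : v = 0 ∨ v = 1 ∨ v = 2 := by omega
    · refine ⟨i + 4, 2 ^ (i + 4) + 4, by omega, by omega, by omega, ?_⟩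
      have hd := two_pow_eq_or_dvd (i + 4)
      rw [powValue_eq_mod_two (by omega) (by omega) (by omega)]
      · omega
      all_goals
        intro l
        have := two_pow_eq_or_dvd l
        omega
    · exact ⟨i + 5, 4, by omega, hi, by ring, by simp [powValue_of_lt]⟩
    · have := (Nat.pow_le_pow_right two_pos hi' : 2 ^ 5 ≤ 2 ^ (i + 5))
      exact ⟨1, 2 ^ (i + 5) + 2, le_rfl, by omega, by ring,
        powValue_two_pow_add_two (by omega) hi⟩
  · obtain ⟨hodd, rfl⟩ : n % 2 = 1 ∧ v = 0 := by omega
    by_cases hex : ∃ i, n = 2 ^ i + 5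
    · obtain ⟨i, rfl⟩ := hex
      have hd := two_pow_eq_or_dvd i
      refine ⟨2, 2 ^ i, by omega, by omega, by ring, ?_⟩
      rw [powValue_eq_mod_two (by omega) (by omega) (by omega)]
      · omega
      all_goals
        intro l
        have := two_pow_eq_or_dvd l
        omega
    · push Not at hex
      refine ⟨1, n - 3, by omega, by omega, by omega, ?_⟩
      rw [powValue_eq_mod_two (by omega) (by omega) (by omega)]
      · omega
      all_goals
        intro l
        have := two_pow_eq_or_dvd l
        have := hex l
        omega

theorem subG_two_pow_add_one {k : ℕ} (hk : 4 ≤ k) (n : ℕ) :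
    subG ((Finset.Icc 1 k).image (fun j => 2 ^ j + 1)) n = powValue k n := by
  apply subG_eq_of_mex
  · simp only [Finset.mem_image]
    rintro s ⟨j, -, rfl⟩
    positivity
  · intro s hs m
    simp only [Finset.mem_image, Finset.mem_Icc] at hs
    obtain ⟨j, ⟨hj, hjk⟩, rfl⟩ := hs
    exact powValue_add_ne m hj hjk
  · intro n v hv
    obtain ⟨j, m, hj, hjk, hm, hval⟩ := exists_powValue_eq hk hv
    exact ⟨2 ^ j + 1, Finset.mem_image_of_mem _ (Finset.mem_Icc.mpr ⟨hj, hjk⟩), m, hm, hval⟩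

theorem exists_forall_subG_three_five {m : ℕ} (hm : 1 ≤ m) :
    ∃ N₀ : ℕ, ∀ n : ℕ, N₀ ≤ n → subG {3, 5, 8 * m + 1} n = n % 2 := by
  refine ⟨16 * m + 8, fun n hn => ?_⟩
  rw [subG_three_five hm, threeFiveValue, if_neg (by omega), if_neg (by omega),
    if_neg (by omega)]
  omega

theorem exists_forall_subG_odd {k : ℕ} (hk : 5 ≤ k) (hodd : k % 2 = 1) :
    ∃ N₀ : ℕ, ∀ n : ℕ, N₀ ≤ n → subG {k, k + 2, 2 * k + 3} n = n % 2 := by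
  refine ⟨3 * k * (k + 1), fun n hn => ?_⟩
  rw [subG_odd hk hodd, oddValue_eq_mod_two hodd ((Nat.le_div_iff_mul_le (by omega)).mpr hn)]
  exact Nat.mod_mod_of_dvd n (by omega)

theorem exists_forall_subG_two_pow_add_one {k : ℕ} (hk : 4 ≤ k) :
    ∃ N₀ : ℕ, ∀ n : ℕ, N₀ ≤ n →
      subG ((Finset.Icc 1 k).image (fun j => 2 ^ j + 1)) n = n % 2 := by
  refine ⟨2 ^ k + 32, fun n hn => ?_⟩
  rw [subG_two_pow_add_one hk]
  refine powValue_of_forall_ne (le_of_add_le_right hn) ?_ ?_ <;>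
  · intro i hi
    have := Nat.pow_le_pow_right two_pos hi
    omega

/-- Cairns–Ho, Theorem 2: three families of ultimately bipartite
subtraction games. -/
theorem cairns_ho_families :
    (∀ k : ℕ, 3 ≤ k →
      ∃ N₀ : ℕ, ∀ n : ℕ, N₀ ≤ n →
        subG ((Finset.Icc 1 k).image (fun j => 2 ^ j + 1)) n = n % 2) ∧
    (∀ k : ℕ, 3 ≤ k →
      ∃ N₀ : ℕ, ∀ n : ℕ, N₀ ≤ n → subG {3, 5, 2 ^ k + 1} n = n % 2) ∧
    (∀ k : ℕ, 3 ≤ k → Odd k →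
      ∃ N₀ : ℕ, ∀ n : ℕ, N₀ ≤ n → subG {k, k + 2, 2 * k + 3} n = n % 2) := by
  refine ⟨fun k hk => ?_, fun k hk => ?_, fun k hk hodd => ?_⟩
  · rcases hk.eq_or_lt with rfl | hlt
    · have h : (Finset.Icc 1 3).image (fun j => 2 ^ j + 1) = {3, 5, 8 * 1 + 1} := by decide
      rw [h]
      exact exists_forall_subG_three_five le_rfl
    · exact exists_forall_subG_two_pow_add_one hlt
  · obtain ⟨i, rfl⟩ := Nat.exists_eq_add_of_le hk
    rw [pow_add]
    exact exists_forall_subG_three_five Nat.one_le_two_pow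
  · rw [Nat.odd_iff] at hodd
    rcases hk.eq_or_lt with rfl | hlt
    · exact exists_forall_subG_three_five le_rfl
    · exact exists_forall_subG_odd (by omega) hodd
end

section
/- (Ho.) Let a > 1 be an odd integer and let b > a be an even positive integer, and consider the subtraction game on S = {1, a, b}. The nim-value sequence is purely periodic with period a + b, one period being the word (01)^{b/2} (23)^{(a−1)/2} 2. Explicitly, writing m = n mod (a + b): G_S(n) = m mod 2 if m < b; G_S(n) = 2 + ((m − b) mod 2) if b ≤ m < a + b − 1; and G_S(n) = 2 if m = a + b − 1. -/
/-- A value that no move attains and all of whose predecessors are attained is the nim-value. -/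
theorem subG_eq_of_mex_s12 {S : Finset ℕ} (hS : ∀ s ∈ S, 0 < s) {n v : ℕ}
    (hv : ∀ s ∈ S, s ≤ n → subG S (n - s) ≠ v)
    (hlt : ∀ k < v, ∃ s ∈ S, s ≤ n ∧ subG S (n - s) = k) : subG S n = v := by
  rw [subG]
  refine IsLeast.csInf_eq ⟨fun s hs _ hn => hv s hs hn, fun k hk => ?_⟩
  by_contra! hkv
  obtain ⟨s, hs, hn, h⟩ := hlt k hkv
  exact hk s hs (hS s hs) hn h

/-- The periodic word `(01)^(b/2) (23)^((a-1)/2) 2`, indexed by `n` modulo `a + b`. -/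
def hoWord (a b n : ℕ) : ℕ :=
  if n % (a + b) < b then n % (a + b) % 2 else 2 + (n % (a + b) - b) % 2

theorem sub_mod_of_le {p n s : ℕ} (hs : s ≤ n) (hsp : s ≤ p) (hp : 0 < p) :
    s ≤ n % p ∧ (n - s) % p = n % p - s ∨
      n % p < s ∧ (n - s) % p = p + n % p - s := by
  have hm := Nat.mod_lt n hp
  have hn := Nat.div_add_mod n p
  rcases le_or_gt s (n % p) with h | h
  · refine Or.inl ⟨h, ?_⟩
    have : n - s = n % p - s + p * (n / p) := by omega
    rw [this, Nat.add_mul_mod_self_left, Nat.mod_eq_of_lt (by omega)]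
  · refine Or.inr ⟨h, ?_⟩
    obtain ⟨q, hq⟩ : ∃ q, n / p = q + 1 :=
      Nat.exists_eq_succ_of_ne_zero fun h0 => by rw [h0, mul_zero] at hn; omega
    rw [hq, mul_add, mul_one] at hn
    have : n - s = p + n % p - s + p * q := by omega
    rw [this, Nat.add_mul_mod_self_left, Nat.mod_eq_of_lt (by omega)]

theorem subG_eq_hoWord {a b : ℕ} (ha1 : 1 < a) (haodd : Odd a) (hbeven : Even b)
    (hab : a < b) (n : ℕ) : subG {1, a, b} n = hoWord a b n := by
  induction n using Nat.strong_induction_on with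
  | _ n ih =>
  have ha2 := Nat.odd_iff.mp haodd
  have hb2 := Nat.even_iff.mp hbeven
  have hm := Nat.mod_lt n (show 0 < a + b by omega)
  have hmn := Nat.mod_le n (a + b)
  have hpos : ∀ s ∈ ({1, a, b} : Finset ℕ), 0 < s := by
    simp only [Finset.mem_insert, Finset.mem_singleton]; omega
  have hstep : ∀ s ∈ ({1, a, b} : Finset ℕ), s ≤ n →
      subG {1, a, b} (n - s) = hoWord a b (n - s) := fun s hs hn =>
    ih _ (by have := hpos s hs; omega)
  have hle : ∀ s ∈ ({1, a, b} : Finset ℕ), s ≤ a + b := by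
    simp only [Finset.mem_insert, Finset.mem_singleton]; omega
  refine subG_eq_of_mex_s12 hpos (fun s hs hn => ?_) fun k hk => ?_
  · rw [hstep s hs hn]
    have hmod := sub_mod_of_le hn (hle s hs) (by omega)
    unfold hoWord
    generalize (n - s) % (a + b) = r at *
    generalize n % (a + b) = m at *
    simp only [Finset.mem_insert, Finset.mem_singleton] at hs
    rcases hs with rfl | rfl | rfl <;> split_ifs <;> omega
  · suffices h : ∃ s ∈ ({1, a, b} : Finset ℕ), s ≤ n % (a + b) ∧
        ∀ r, r = n % (a + b) - s → (if r < b then r % 2 else 2 + (r - b) % 2) = k by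
      obtain ⟨s, hs, hsm, h⟩ := h
      have hn := hsm.trans hmn
      refine ⟨s, hs, hn, ?_⟩
      rw [hstep s hs hn]
      have hmod := sub_mod_of_le hn (hle s hs) (by omega)
      exact h _ (by omega)
    unfold hoWord at hk
    generalize n % (a + b) = m at *
    simp only [Finset.mem_insert, Finset.mem_singleton, exists_eq_or_imp, exists_eq_left,
      forall_eq]
    split_ifs at * <;> omega

/-- Ho: for odd `a > 1` and even `b > a`, `S = {1, a, b}` is purely
periodic with period `a + b`, one period being `(01)^(b/2) (23)^((a-1)/2) 2`. -/
theorem ho_three_move (a b : ℕ) (ha1 : 1 < a) (haodd : Odd a)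
    (hb : 0 < b) (hbeven : Even b) (hab : a < b) :
    (∀ n : ℕ, subG {1, a, b} (n + (a + b)) = subG {1, a, b} n) ∧
    (∀ n : ℕ,
      (n % (a + b) < b → subG {1, a, b} n = n % (a + b) % 2) ∧
      (b ≤ n % (a + b) → n % (a + b) < a + b - 1 →
        subG {1, a, b} n = 2 + (n % (a + b) - b) % 2) ∧
      (n % (a + b) = a + b - 1 → subG {1, a, b} n = 2)) := by
  have ha2 := Nat.odd_iff.mp haodd
  simp only [subG_eq_hoWord ha1 haodd hbeven hab, hoWord, Nat.add_mod_right, implies_true,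
    true_and]
  intro n
  generalize n % (a + b) = m
  split_ifs <;> omega
end

section
/- (Siegel, arithmetic periodicity of all-but nim.) Let S be a finite set of positive integers. Then the nim-value sequence of all-but nim with FES set S is arithmetic periodic: there exist integers l ≥ 0, p > 0 and s > 0 such that G(n + p) = G(n) + s for all n ≥ l. -/
/-- Nim-value of all-but nim ("finite excluded subtraction") with FES set `S`:
`fesG S n = mex { fesG S (n - m) : 1 ≤ m ≤ n, m ∉ S }`. -/
noncomputable def fesG (S : Finset ℕ) : ℕ → ℕ
  | n => sInf {k : ℕ | ∀ (m : ℕ) (hm : 0 < m) (hn : m ≤ n), m ∉ S → fesG S (n - m) ≠ k}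
  decreasing_by exact Nat.sub_lt (Nat.lt_of_lt_of_le hm hn) hm

/-- The value at `n` differs from the value at every option of `n`. -/
theorem fesG_ne_of_notMem (S : Finset ℕ) {m n : ℕ} (hmn : m < n) (hS : n - m ∉ S) :
    fesG S m ≠ fesG S n := by
  have hne : {k : ℕ | ∀ (m : ℕ) (_ : 0 < m) (_ : m ≤ n), m ∉ S →
      fesG S (n - m) ≠ k}.Nonempty := by
    refine ⟨(Finset.range n).sup (fesG S) + 1, fun m hm hn _ => ?_⟩
    have : fesG S (n - m) ≤ (Finset.range n).sup (fesG S) :=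
      Finset.le_sup (Finset.mem_range.2 (by omega))
    omega
  have h := Nat.sInf_mem hne
  rw [← fesG.eq_1 S n] at h
  have h' := h (n - m) (by omega) (by omega) hS
  rwa [Nat.sub_sub_self hmn.le] at h'

/-- Every value smaller than the value at `n` is the value at an option of `n`. -/
theorem exists_fesG_eq_of_lt (S : Finset ℕ) {k n : ℕ} (hk : k < fesG S n) :
    ∃ m < n, n - m ∉ S ∧ fesG S m = k := by
  rw [fesG.eq_1] at hk
  have h := Nat.notMem_of_lt_sInf hk
  simp only [Set.mem_ofPred_eq, not_forall, not_not] at h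
  obtain ⟨m, hm, hn, hS, h⟩ := h
  exact ⟨n - m, by omega, by rwa [Nat.sub_sub_self hn], h⟩

theorem fesG_eq_iff_of_le (S : Finset ℕ) {k n : ℕ} (hk : k ≤ fesG S n) :
    fesG S n = k ↔ ∀ m < n, n - m ∉ S → fesG S m ≠ k := by
  refine ⟨fun h m hm hS => h ▸ fesG_ne_of_notMem S hm hS, fun h => ?_⟩
  by_contra hne
  obtain ⟨m, hm, hS, hmk⟩ := exists_fesG_eq_of_lt S (lt_of_le_of_ne hk (Ne.symm hne))
  exact h m hm hS hmk

/-- A value is repeated only at distances in `S`. -/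
theorem fesG_ne_of_sup_lt (S : Finset ℕ) {m n : ℕ} (h : m + S.sup id < n) :
    fesG S m ≠ fesG S n :=
  fesG_ne_of_notMem S (by omega) fun hS => by
    have : n - m ≤ S.sup id := Finset.le_sup (f := id) hS
    omega

theorem exists_forall_le_fesG (S : Finset ℕ) (k : ℕ) : ∃ l, ∀ n, l ≤ n → k ≤ fesG S n := by
  induction k with
  | zero => exact ⟨0, fun _ _ => Nat.zero_le _⟩
  | succ k ih =>
    obtain ⟨l, hl⟩ := ih
    by_cases h : ∃ n₀, fesG S n₀ = k
    · obtain ⟨n₀, hn₀⟩ := h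
      refine ⟨max l (n₀ + S.sup id + 1), fun n hn => ?_⟩
      have h₁ := hl n (by omega)
      have h₂ := fesG_ne_of_sup_lt S (m := n₀) (n := n) (by omega)
      omega
    · refine ⟨l, fun n hn => ?_⟩
      have h₁ := hl n hn
      have h₂ : fesG S n ≠ k := fun e => h ⟨n, e⟩
      omega

/-- There is a first position of value at least `k`; its value is `k`, and all positions
further than `max S` beyond it have value at least `k`. -/
theorem exists_first_fesG (S : Finset ℕ) (k : ℕ) :
    ∃ a, fesG S a = k ∧ (∀ n < a, fesG S n < k) ∧ ∀ n, a + S.sup id < n → k ≤ fesG S n := by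
  have key : ∀ k, ∃ a, fesG S a = k ∧ ∀ n < a, fesG S n < k := fun k => by
    classical
    obtain ⟨l, hl⟩ := exists_forall_le_fesG S k
    have hex : ∃ n, k ≤ fesG S n := ⟨l, hl l le_rfl⟩
    have hmin : ∀ n < Nat.find hex, fesG S n < k := fun n hn => not_le.1 (Nat.find_min hex hn)
    refine ⟨Nat.find hex, ?_, hmin⟩
    rw [fesG_eq_iff_of_le S (Nat.find_spec hex)]
    exact fun m hm _ => (hmin m hm).ne
  obtain ⟨a, ha, hmin⟩ := key k
  refine ⟨a, ha, hmin, fun n hn => ?_⟩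
  by_contra! hlt
  obtain ⟨b, hb, hbmin⟩ := key (fesG S n)
  have hba : b ≤ a := by
    by_contra! hab
    have := hbmin a hab
    omega
  exact fesG_ne_of_sup_lt S (by omega) hb

/-- If the positions of value at least `j` are the positions of value at least `i` shifted
by `p`, then the same holds for the positions of value exactly `j` and `i`. -/
theorem fesG_eq_iff_shift (S : Finset ℕ) {i j p : ℕ}
    (h : ∀ n, i ≤ fesG S n ↔ j ≤ fesG S (n + p)) (hp : ∀ m < p, fesG S m < j) (n : ℕ) :
    fesG S n = i ↔ fesG S (n + p) = j := by
  induction n using Nat.strong_induction_on with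
  | _ n ih =>
    by_cases hi : i ≤ fesG S n
    · rw [fesG_eq_iff_of_le S hi, fesG_eq_iff_of_le S ((h n).1 hi)]
      constructor
      · intro H m hm hS
        rcases lt_or_ge m p with hmp | hmp
        · exact (hp m hmp).ne
        · obtain ⟨m, rfl⟩ := Nat.exists_eq_add_of_le' hmp
          rw [Nat.add_sub_add_right] at hS
          exact fun e => H m (by omega) hS ((ih m (by omega)).2 e)
      · intro H m hm hS e
        exact H (m + p) (by omega) (by rwa [Nat.add_sub_add_right]) ((ih m hm).1 e)
    · have := mt (h n).2 hi
      omega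

theorem le_fesG_iff_shift (S : Finset ℕ) {i j p : ℕ}
    (h : ∀ n, i ≤ fesG S n ↔ j ≤ fesG S (n + p)) (hp : ∀ m < p, fesG S m < j) (t n : ℕ) :
    i + t ≤ fesG S n ↔ j + t ≤ fesG S (n + p) := by
  induction t generalizing n with
  | zero => exact h n
  | succ t ih =>
    have h₁ := fesG_eq_iff_shift S ih (fun m hm => (hp m hm).trans_le (Nat.le_add_right j t)) n
    have h₂ := ih n
    omega

/-- Siegel: the nim-value sequence of all-but nim with a finite FES set
is arithmetic periodic. -/
theorem siegel_arithmetic_periodic (S : Finset ℕ) (hpos : ∀ s ∈ S, 0 < s) :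
    ∃ (l p s : ℕ), 0 < p ∧ 0 < s ∧
      ∀ n : ℕ, l ≤ n → fesG S (n + p) = fesG S n + s := by
  choose a ha hmin hlarge using exists_first_fesG S
  let state : ℕ → (Fin (S.sup id + 1) → Prop) := fun k d => k ≤ fesG S (a k + d)
  obtain ⟨i, j, hij, hstate⟩ : ∃ i j, i < j ∧ state i = state j := by
    obtain ⟨i, j, hne, h⟩ := Finite.exists_ne_map_eq_of_infinite state
    rcases hne.lt_or_gt with hlt | hlt
    exacts [⟨i, j, hlt, h⟩, ⟨j, i, hlt, h.symm⟩]
  have hlt : a i < a j := by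
    by_contra! hle
    have h₁ := ha i
    have h₂ := ha j
    rcases hle.lt_or_eq with h | h
    · have := hmin i _ h
      omega
    · rw [h] at h₂
      omega
  obtain ⟨p, hp⟩ := Nat.exists_eq_add_of_lt hlt
  have hshift : ∀ n, i ≤ fesG S n ↔ j ≤ fesG S (n + (p + 1)) := by
    intro n
    rcases lt_or_ge n (a i) with hn | hn
    · have h₁ := hmin i n hn
      have h₂ := hmin j (n + (p + 1)) (by omega)
      omega
    · obtain ⟨d, rfl⟩ := Nat.exists_eq_add_of_le hn
      rcases lt_or_ge (S.sup id) d with hd | hd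
      · exact iff_of_true (hlarge i _ (by omega)) (hlarge j _ (by omega))
      · have h := congrFun hstate ⟨d, by omega⟩
        simp only [state, eq_iff_iff] at h
        rw [h, hp]
        congr! 2
        omega
  have hbelow : ∀ m < p + 1, fesG S m < j := fun m hm => hmin j m (by omega)
  refine ⟨a i + S.sup id + 1, p + 1, j - i, by omega, by omega, fun n hn => ?_⟩
  have hi := hlarge i n (by omega)
  have h₁ := le_fesG_iff_shift S hshift hbelow (fesG S n - i) n
  have h₂ := le_fesG_iff_shift S hshift hbelow (fesG S n - i + 1) n
  omega
end

section
/- (Siegel, all-but nim with one or two excluded moves.) Let a be a positive integer. In all-but nim with FES set S = {a}, the nim-values are G(n) = a·⌊n/(2a)⌋ + (n mod a) for all n ≥ 0 (purely arithmetic periodic of the form (0…(a−1))² + a). Moreover, if S = {a, b} with a < b, then G(n) = a·⌊n/(2a)⌋ + (n mod a) for all n when b ≠ 2a, and G(n) = a·⌊n/(3a)⌋ + (n mod a) for all n when b = 2a. -/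
/-- A function satisfying the mex recursion is the nim-value function. -/
theorem fesG_eq_of_mex (S : Finset ℕ) (f : ℕ → ℕ)
    (hne : ∀ n m, 0 < m → m ≤ n → m ∉ S → f (n - m) ≠ f n)
    (hlt : ∀ n k, k < f n → ∃ m, 0 < m ∧ m ≤ n ∧ m ∉ S ∧ f (n - m) = k) (n : ℕ) :
    fesG S n = f n := by
  induction n using Nat.strong_induction_on with
  | _ n ih =>
    rw [fesG]
    have hmem : ∀ m, 0 < m → m ≤ n → m ∉ S → fesG S (n - m) ≠ f n := fun m hm hn hS => by
      rw [ih (n - m) (by omega)]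
      exact hne n m hm hn hS
    refine le_antisymm (Nat.sInf_le hmem) (le_csInf ⟨f n, hmem⟩ fun k hk => ?_)
    by_contra! hkn
    obtain ⟨m, hm, hmn, hS, hf⟩ := hlt n k hkn
    exact hk m hm hmn hS (by rw [ih (n - m) (by omega), hf])

theorem saltus_apply {a c Q J R : ℕ} (hJ : J < c) (hR : R < a) :
    a * ((a * (c * Q + J) + R) / (c * a)) + (a * (c * Q + J) + R) % a = a * Q + R := by
  have ha : 0 < a := by omega
  rw [mul_comm c a, ← Nat.div_div_eq_div_mul, Nat.mul_add_div ha, Nat.div_eq_of_lt hR,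
    Nat.mul_add_mod, Nat.mod_eq_of_lt hR, add_zero, Nat.mul_add_div (by omega),
    Nat.div_eq_of_lt hJ, add_zero]

theorem exists_saltus_repr {a c : ℕ} (ha : 0 < a) (hc : 0 < c) (n : ℕ) :
    ∃ Q J R, J < c ∧ R < a ∧ n = a * (c * Q + J) + R :=
  ⟨n / a / c, n / a % c, n % a, Nat.mod_lt _ hc, Nat.mod_lt _ ha, by
    rw [Nat.div_add_mod, Nat.div_add_mod]⟩

/-- Nim-values of the form `(0…(a-1))ᶜ + a`: it suffices that `S` contains the multiples
`a, …, (c-1)a`, that it has no element below `a`, and that it contains no progression of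
length `c` with difference `a`. -/
theorem fesG_eq_saltus {S : Finset ℕ} {a c : ℕ} (ha : 0 < a) (hc : 0 < c)
    (hmul : ∀ j, 0 < j → j < c → a * j ∈ S) (hle : ∀ m ∈ S, a ≤ m)
    (hfree : ∀ m, 0 < m → ∃ j < c, m + a * j ∉ S) (n : ℕ) :
    fesG S n = a * (n / (c * a)) + n % a := by
  refine fesG_eq_of_mex S (fun n => a * (n / (c * a)) + n % a) ?_ ?_ n
  · intro n m hm hmn hS heq
    obtain ⟨Q, J, R, hJ, hR, hn⟩ := exists_saltus_repr ha hc n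
    obtain ⟨Q', J', R', hJ', hR', hn'⟩ := exists_saltus_repr ha hc (n - m)
    simp only [hn'] at heq
    simp only [hn] at heq
    rw [saltus_apply hJ hR, saltus_apply hJ' hR'] at heq
    have hRR : R' = R := by
      simpa [Nat.mul_add_mod, Nat.mod_eq_of_lt hR, Nat.mod_eq_of_lt hR'] using
        congrArg (· % a) heq
    subst hRR
    obtain rfl : Q' = Q := Nat.eq_of_mul_eq_mul_left ha (by omega)
    have hJJ : J' < J := by
      by_contra! h
      have := Nat.mul_le_mul_left a (Nat.add_le_add_left h (c * Q'))
      omega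
    obtain ⟨j, rfl⟩ := Nat.exists_eq_add_of_lt hJJ
    refine hS ?_
    have hmj : m = a * (j + 1) := by
      have : a * (c * Q' + (J' + j + 1)) = a * (c * Q' + J') + a * (j + 1) := by ring
      omega
    exact hmj ▸ hmul (j + 1) (by omega) (by omega)
  · intro n k hk
    obtain ⟨Q, J, R, hJ, hR, rfl⟩ := exists_saltus_repr ha hc n
    rw [saltus_apply hJ hR] at hk
    obtain ⟨q, r, hr, rfl⟩ : ∃ q r, r < a ∧ k = a * q + r :=
      ⟨k / a, k % a, Nat.mod_lt _ ha, (Nat.div_add_mod k a).symm⟩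
    have hqQ : q ≤ Q := by
      by_contra! h
      have := Nat.mul_le_mul_left a (Nat.succ_le_of_lt h)
      rw [Nat.mul_succ] at this
      omega
    rcases hqQ.eq_or_lt with rfl | hlt
    · refine ⟨R - r, by omega, by omega, fun h => ?_, ?_⟩
      · have := hle _ h
        omega
      · rw [show a * (c * q + J) + R - (R - r) = a * (c * q + J) + r by omega]
        exact saltus_apply hJ hr
    · have hstep : a * (c * q + (c - 1)) + a ≤ a * (c * Q + J) := by
        rw [← Nat.mul_succ]
        refine Nat.mul_le_mul_left a ?_
        have := Nat.mul_le_mul_left c (Nat.succ_le_of_lt hlt)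
        rw [Nat.mul_succ] at this
        omega
      obtain ⟨j, hj, hjS⟩ :=
        hfree (a * (c * Q + J) + R - (a * (c * q + (c - 1)) + r)) (by omega)
      have hsplit : a * (c * q + (c - 1)) = a * (c * q + (c - 1 - j)) + a * j := by
        rw [← Nat.mul_add]
        congr 1
        omega
      refine ⟨_, by omega, by omega, hjS, ?_⟩
      rw [show a * (c * Q + J) + R - (a * (c * Q + J) + R - (a * (c * q + (c - 1)) + r) + a * j)
        = a * (c * q + (c - 1 - j)) + r by omega]
      exact saltus_apply (by omega) hr

/-- Siegel, one or two excluded moves: for `S = {a}` the nim-values are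
`G(n) = a·⌊n/(2a)⌋ + (n mod a)`, i.e. `(0…(a-1))² + a`; for `S = {a, b}` with `a < b`
they are the same if `b ≠ 2a`, and `G(n) = a·⌊n/(3a)⌋ + (n mod a)`, i.e.
`(0…(a-1))³ + a`, if `b = 2a`. -/
theorem siegel_small_fes (a : ℕ) (ha : 0 < a) :
    (∀ n : ℕ, fesG {a} n = a * (n / (2 * a)) + n % a) ∧
    (∀ b : ℕ, a < b →
      (b ≠ 2 * a → ∀ n : ℕ, fesG {a, b} n = a * (n / (2 * a)) + n % a) ∧
      (b = 2 * a → ∀ n : ℕ, fesG {a, b} n = a * (n / (3 * a)) + n % a)) := by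
  have two : ∀ S : Finset ℕ, a ∈ S → (∀ m ∈ S, a ≤ m) → (∀ m ∈ S, m + a ∉ S) →
      ∀ n : ℕ, fesG S n = a * (n / (2 * a)) + n % a := by
    intro S haS hle hfree
    refine fesG_eq_saltus ha two_pos (fun j h0 h2 => ?_) hle fun m _ => ?_
    · obtain rfl : j = 1 := by omega
      simpa using haS
    · by_cases hm : m ∈ S
      · exact ⟨1, by omega, by simpa using hfree m hm⟩
      · exact ⟨0, by omega, by simpa using hm⟩
  refine ⟨two {a} (by simp) (by simp) (by simp; omega), fun b hab => ⟨fun hb => ?_, ?_⟩⟩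
  · refine two {a, b} (by simp) ?_ ?_ <;>
      simp only [Finset.mem_insert, Finset.mem_singleton] <;> omega
  · rintro rfl
    refine fesG_eq_saltus ha three_pos (fun j h0 h3 => ?_) ?_ fun m _ => ⟨2, by omega, ?_⟩
    · interval_cases j <;> simp [mul_comm]
    all_goals
      simp only [Finset.mem_insert, Finset.mem_singleton]
      omega
end

section
/- (Sleator–Slusky.) Let a < b < c be positive integers and let S = {a, b, c}. Then the nim-value sequence of all-but nim with FES set S is purely arithmetic periodic: there exist integers p > 0 and s > 0 such that G(n + p) = G(n) + s for all n ≥ 0. -/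
/-- The nim-value of `n` differs from that of every option `i` of `n`. -/
theorem fesG_ne {S : Finset ℕ} {n i : ℕ} (hi : i < n) (hS : n - i ∉ S) :
    fesG S i ≠ fesG S n := by
  have hne : {k : ℕ | ∀ (m : ℕ) (_ : 0 < m) (_ : m ≤ n), m ∉ S → fesG S (n - m) ≠ k}.Nonempty := by
    refine ⟨(Finset.range n).sup (fesG S) + 1, fun m hm hn _ h => ?_⟩
    have hle : fesG S (n - m) ≤ (Finset.range n).sup (fesG S) :=
      Finset.le_sup (Finset.mem_range.2 (by omega))
    omega
  have hmem := Nat.sInf_mem hne (n - i) (by omega) (by omega) hS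
  rw [show n - (n - i) = i by omega] at hmem
  rwa [fesG.eq_1 S n]

/-- Every value below the nim-value of `n` is attained at an option of `n`. -/
theorem exists_fesG_eq {S : Finset ℕ} {n j : ℕ} (hj : j < fesG S n) :
    ∃ i < n, fesG S i = j ∧ n - i ∉ S := by
  rw [fesG.eq_1 S n] at hj
  have h := Nat.notMem_of_lt_sInf hj
  simp only [Set.mem_ofPred_eq, not_forall, not_not] at h
  obtain ⟨m, hm, hn, hS, h⟩ := h
  exact ⟨n - m, by omega, h, by rwa [show n - (n - m) = m by omega]⟩

/-- Positions with equal nim-values differ by an excluded subtraction. -/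
theorem sub_mem_of_fesG_eq {S : Finset ℕ} {n i : ℕ} (hi : i < n) (h : fesG S i = fesG S n) :
    n - i ∈ S :=
  by_contra fun hS => fesG_ne hi hS h

/-- A value all of whose occurrences before `n` are excluded for `n` bounds the nim-value of `n`
from above. -/
theorem fesG_le {S : Finset ℕ} {n j : ℕ} (h : ∀ i < n, fesG S i = j → n - i ∈ S) :
    fesG S n ≤ j := by
  by_contra! hj
  obtain ⟨i, hi, hij, hS⟩ := exists_fesG_eq hj
  exact hS (h i hi hij)

/-- If the positions with nim-value below `s` form the initial segment `[0, p)`, then the nim-value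
sequence is arithmetic periodic with period `p` and saltus `s`. -/
theorem fesG_add_of_lt_iff {S : Finset ℕ} {p s : ℕ} (h : ∀ n, fesG S n < s ↔ n < p) (n : ℕ) :
    fesG S (n + p) = fesG S n + s := by
  induction n using Nat.strong_induction_on with
  | _ n ih =>
    apply le_antisymm
    · apply fesG_le
      intro i hi hG
      have hip : p ≤ i := by
        by_contra! hip
        have := (h i).2 hip
        omega
      have hin := ih (i - p) (by omega)
      rw [Nat.sub_add_cancel hip] at hin
      have := sub_mem_of_fesG_eq (S := S) (i := i - p) (n := n) (by omega) (by omega)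
      rwa [show n - (i - p) = n + p - i by omega] at this
    · have hs : s ≤ fesG S (n + p) := by
        by_contra! hs
        have := (h _).1 hs
        omega
      have hle : fesG S n ≤ fesG S (n + p) - s := by
        apply fesG_le
        intro i hi hG
        have := sub_mem_of_fesG_eq (S := S) (i := i + p) (n := n + p) (by omega)
          (by rw [ih i hi]; omega)
        rwa [show n + p - (i + p) = n - i by omega] at this
      omega

/-- If `a` is a lower bound of `S`, the multiples `a, 2a, …, (k-1)a` lie in `S` and no `k`-term
progression of difference `a` in `S` exists, then the positions below `k * a` are exactly
those with nim-value below `a`. -/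
theorem fesG_lt_iff_lt_mul {S : Finset ℕ} {a k : ℕ} (ha : 0 < a) (hmin : ∀ m ∈ S, a ≤ m)
    (hmul : ∀ i, 0 < i → i < k → i * a ∈ S)
    (hprog : ∀ d, ∃ i < k, d - i * a ∉ S) (n : ℕ) :
    fesG S n < a ↔ n < k * a := by
  have hmod : ∀ n, n < k * a → fesG S n = n % a := by
    intro n
    induction n using Nat.strong_induction_on with
    | _ n ih =>
      intro hn
      apply le_antisymm
      · apply fesG_le
        intro i hi hG
        rw [ih i hi (by omega)] at hG
        obtain ⟨q, hq⟩ := (Nat.modEq_iff_dvd' hi.le).1 hG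
        rw [hq, mul_comm]
        apply hmul
        · by_contra! h0
          have : q = 0 := by omega
          subst this
          omega
        · by_contra! hk
          have := Nat.mul_le_mul_right a hk
          rw [mul_comm q a] at this
          omega
      · by_contra! hlt
        have hr : n % a < a := Nat.mod_lt _ ha
        have hrn : n % a ≤ n := Nat.mod_le _ _
        set i := n - (n % a - fesG S n) with hidef
        have hi : i < n := by omega
        have hia : i % a = fesG S n := by
          have hd := Nat.div_add_mod n a
          have : i = fesG S n + a * (n / a) := by omega
          rw [this, Nat.add_mul_mod_self_left, Nat.mod_eq_of_lt (by omega)]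
        have := hmin _ (sub_mem_of_fesG_eq hi ((ih i hi (by omega)).trans hia))
        omega
  constructor
  · intro hlt
    by_contra! hn
    obtain ⟨i, hik, hi⟩ := hprog (n - fesG S n)
    have hia : (i + 1) * a ≤ k * a := Nat.mul_le_mul_right a hik
    rw [add_mul, one_mul] at hia
    have hval : fesG S (fesG S n + i * a) = fesG S n := by
      rw [hmod _ (by omega), Nat.add_mul_mod_self_right, Nat.mod_eq_of_lt hlt]
    have := sub_mem_of_fesG_eq (by omega) hval
    rw [← Nat.sub_sub] at this
    exact hi this
  · intro hn
    rw [hmod n hn]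
    exact Nat.mod_lt _ ha

/-- Every natural number is a nim-value. -/
theorem fesG_surjective (S : Finset ℕ) : Function.Surjective (fesG S) := by
  intro v
  by_contra! hv
  have hlt : ∀ n, fesG S n < v := by
    intro n
    by_contra! hle
    obtain ⟨i, -, hi, -⟩ := exists_fesG_eq (lt_of_le_of_ne hle (hv n).symm)
    exact hv i hi
  set c := S.sup id
  let f : ℕ → Fin v := fun t => ⟨fesG S (t * (c + 1)), hlt _⟩
  obtain ⟨t, u, htu, hf⟩ := Finite.exists_ne_map_eq_of_infinite f
  wlog h : t < u generalizing t u
  · exact this u t htu.symm hf.symm (by omega)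
  have hmul : (t + 1) * (c + 1) ≤ u * (c + 1) := Nat.mul_le_mul_right _ h
  rw [add_mul, one_mul] at hmul
  have hm := sub_mem_of_fesG_eq (by omega) (Fin.mk.inj_iff.1 hf)
  have : _ ≤ c := Finset.le_sup (f := id) hm
  simp only [id] at this
  omega

/-- The least position with nim-value `v`. -/
noncomputable def fesFirst (S : Finset ℕ) (v : ℕ) : ℕ := sInf {n | fesG S n = v}

theorem fesG_fesFirst (S : Finset ℕ) (v : ℕ) : fesG S (fesFirst S v) = v :=
  Nat.sInf_mem (s := {n | fesG S n = v}) (fesG_surjective S v)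

theorem fesFirst_le {S : Finset ℕ} {v n : ℕ} (h : fesG S n = v) : fesFirst S v ≤ n :=
  Nat.sInf_le h

theorem fesG_lt_of_lt_fesFirst {S : Finset ℕ} {v n : ℕ} (h : n < fesFirst S v) :
    fesG S n < v := by
  by_contra! hle
  rcases hle.eq_or_lt with heq | hlt
  · have := fesFirst_le heq.symm
    omega
  · obtain ⟨i, hi, hiv, -⟩ := exists_fesG_eq hlt
    have := fesFirst_le hiv
    omega

theorem fesFirst_lt_fesFirst {S : Finset ℕ} {u v : ℕ} (h : u < v) :
    fesFirst S u < fesFirst S v := by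
  by_contra! hle
  rcases hle.eq_or_lt with heq | hlt
  · have hu := fesG_fesFirst S u
    rw [← heq, fesG_fesFirst] at hu
    omega
  · have := fesG_lt_of_lt_fesFirst hlt
    rw [fesG_fesFirst] at this
    omega

theorem eq_fesFirst_or_sub_mem {S : Finset ℕ} {v n : ℕ} (h : fesG S n = v) :
    n = fesFirst S v ∨ n - fesFirst S v ∈ S := by
  rcases (fesFirst_le h).eq_or_lt with heq | hlt
  · exact Or.inl heq.symm
  · exact Or.inr (sub_mem_of_fesG_eq hlt ((fesG_fesFirst S v).trans h.symm))

section Sum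

variable {a b : ℕ}

theorem eq_of_fesG_eq {v n : ℕ} (ha : 0 < a)
    (h : fesG {a, b, a + b} n = v) :
    n = fesFirst {a, b, a + b} v ∨ n = fesFirst {a, b, a + b} v + a ∨
      n = fesFirst {a, b, a + b} v + b ∨ n = fesFirst {a, b, a + b} v + (a + b) := by
  have h1 := eq_fesFirst_or_sub_mem h
  have h2 := fesFirst_le h
  simp only [Finset.mem_insert, Finset.mem_singleton] at h1
  omega

theorem lt_fesFirst_add_of_fesG_lt {v n : ℕ} (ha : 0 < a)
    (h : fesG {a, b, a + b} n < v) : n < fesFirst {a, b, a + b} v + (a + b) := by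
  have h1 := eq_of_fesG_eq ha (rfl : fesG {a, b, a + b} n = _)
  have h2 := fesFirst_lt_fesFirst (S := {a, b, a + b}) h
  omega

theorem fesG_fesFirst_add_add (ha : 0 < a) (v : ℕ) :
    fesG {a, b, a + b} (fesFirst {a, b, a + b} v + (a + b)) = v := by
  apply le_antisymm
  · apply fesG_le
    intro i hi hG
    have := eq_of_fesG_eq ha hG
    simp only [Finset.mem_insert, Finset.mem_singleton]
    omega
  · by_contra! hlt
    have := lt_fesFirst_add_of_fesG_lt ha hlt
    omega

theorem le_fesG_fesFirst_add_right (ha : 0 < a) (hab : a < b) (v : ℕ) :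
    v ≤ fesG {a, b, a + b} (fesFirst {a, b, a + b} v + b) := by
  by_contra! hlt
  set u := fesG {a, b, a + b} (fesFirst {a, b, a + b} v + b) with hu
  have h1 := eq_of_fesG_eq ha hu.symm
  have h2 := fesFirst_lt_fesFirst (S := {a, b, a + b}) hlt
  have h3 : fesG {a, b, a + b} (fesFirst {a, b, a + b} v) ≤ u := by
    apply fesG_le
    intro i hi hG
    have := eq_of_fesG_eq ha hG
    simp only [Finset.mem_insert, Finset.mem_singleton]
    omega
  rw [fesG_fesFirst] at h3
  omega

/-- Each nim-value occurs exactly once strictly between its first and its last occurrence: either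
`b` or `a` after the first one. -/
theorem fesG_fesFirst_add_right_eq_iff (ha : 0 < a) (hab : a < b) (hb : b ≠ 2 * a) (v : ℕ) :
    fesG {a, b, a + b} (fesFirst {a, b, a + b} v + b) = v ↔
      fesG {a, b, a + b} (fesFirst {a, b, a + b} v + a) ≠ v := by
  constructor
  · intro h1 h2
    have := sub_mem_of_fesG_eq (by omega) (h2.trans h1.symm)
    simp only [Finset.mem_insert, Finset.mem_singleton] at this
    omega
  · intro h
    refine le_antisymm (fesG_le ?_) (le_fesG_fesFirst_add_right ha hab v)
    intro i hi hG
    have hia : i ≠ fesFirst {a, b, a + b} v + a := fun h' => h (h' ▸ hG)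
    have := eq_of_fesG_eq ha hG
    simp only [Finset.mem_insert, Finset.mem_singleton]
    omega

/-- The positions of nim-value below `w` are `[0, h)` together with the shift by `h` of the
positions of nim-value below `v`. -/
def FesShift (S : Finset ℕ) (v w h : ℕ) : Prop :=
  (∀ n, fesG S n < v ↔ fesG S (n + h) < w) ∧ ∀ n < h, fesG S n < w

theorem fesG_lt_iff_lt_succ (ha : 0 < a) (hab : a < b) (hb : b ≠ 2 * a) (v n : ℕ) :
    fesG {a, b, a + b} n < v ↔ fesG {a, b, a + b} n < v + 1 ∧
      n ≠ fesFirst {a, b, a + b} v ∧ n ≠ fesFirst {a, b, a + b} v + (a + b) ∧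
      (fesG {a, b, a + b} (fesFirst {a, b, a + b} v + b) < v + 1 →
        n ≠ fesFirst {a, b, a + b} v + b) ∧
      (¬ fesG {a, b, a + b} (fesFirst {a, b, a + b} v + b) < v + 1 →
        n ≠ fesFirst {a, b, a + b} v + a) := by
  have hfirst := fesG_fesFirst {a, b, a + b} v
  have hlast := fesG_fesFirst_add_add (b := b) ha v
  have hright := le_fesG_fesFirst_add_right ha hab v
  have hiff := fesG_fesFirst_add_right_eq_iff ha hab hb v
  constructor
  · intro h
    refine ⟨by omega, ?_, ?_, ?_, ?_⟩
    · rintro rfl; omega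
    · rintro rfl; omega
    · rintro h5 rfl; omega
    · rintro h5 rfl; omega
  · rintro ⟨h, h1, h2, h3, h4⟩
    by_contra! hle
    have hn : fesG {a, b, a + b} n = v := by omega
    rcases eq_of_fesG_eq ha hn with h' | h' | h' | h'
    · exact h1 h'
    · rw [← h'] at hiff
      exact h4 (by omega) h'
    · exact h3 (by rw [← h']; exact h) h'
    · exact h2 h'

theorem FesShift.of_succ (ha : 0 < a) (hab : a < b) (hb : b ≠ 2 * a) {v w h : ℕ}
    (H : FesShift {a, b, a + b} (v + 1) (w + 1) h) : FesShift {a, b, a + b} v w h := by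
  obtain ⟨H1, H2⟩ := H
  have bound (u n : ℕ) (hu : fesG {a, b, a + b} n < u + 1) :
      n ≤ fesFirst {a, b, a + b} u + (a + b) := by
    rcases (Nat.lt_succ_iff.1 hu).eq_or_lt with heq | hlt
    · have := eq_of_fesG_eq ha heq
      omega
    · exact (lt_fesFirst_add_of_fesG_lt ha hlt).le
  have hlast (u : ℕ) := fesG_fesFirst_add_add (b := b) ha u
  have hle := bound w _ ((H1 _).1 (by rw [hlast v]; omega))
  have hge := bound v (fesFirst {a, b, a + b} w + (a + b) - h)
    ((H1 _).2 (by rw [Nat.sub_add_cancel (by omega), hlast w]; omega))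
  have hx : fesFirst {a, b, a + b} w = fesFirst {a, b, a + b} v + h := by omega
  refine ⟨fun n => ?_, fun n hn => fesG_lt_of_lt_fesFirst (by omega)⟩
  have hright := H1 (fesFirst {a, b, a + b} v + b)
  rw [show fesFirst {a, b, a + b} v + b + h = fesFirst {a, b, a + b} w + b by omega] at hright
  rw [fesG_lt_iff_lt_succ ha hab hb v n, fesG_lt_iff_lt_succ ha hab hb w (n + h), hright, H1 n]
  omega

theorem FesShift.sub (ha : 0 < a) (hab : a < b) (hb : b ≠ 2 * a) {v d h : ℕ}
    (H : FesShift {a, b, a + b} v (v + d) h) : FesShift {a, b, a + b} 0 d h := by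
  induction v with
  | zero => simpa using H
  | succ v ih => exact ih (FesShift.of_succ ha hab hb (by rwa [add_right_comm] at H))

theorem exists_fesShift (ha : 0 < a) :
    ∃ v d h, 0 < d ∧ FesShift {a, b, a + b} v (v + d) h := by
  let code : ℕ → Finset (Fin (a + b)) := fun v =>
    {i | fesG {a, b, a + b} (fesFirst {a, b, a + b} v + i) < v}
  obtain ⟨v, w, hvw, hcode⟩ := Finite.exists_ne_map_eq_of_infinite code
  wlog hlt : v < w generalizing v w
  · exact this w v hvw.symm hcode.symm (by omega)
  have hx := fesFirst_lt_fesFirst (S := {a, b, a + b}) hlt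
  refine ⟨v, w - v, fesFirst {a, b, a + b} w - fesFirst {a, b, a + b} v, by omega, ?_⟩
  rw [show v + (w - v) = w by omega]
  refine ⟨fun n => ?_, fun n hn => fesG_lt_of_lt_fesFirst (by omega)⟩
  rcases lt_or_ge n (fesFirst {a, b, a + b} v) with hn | hn
  · exact iff_of_true (fesG_lt_of_lt_fesFirst hn) (fesG_lt_of_lt_fesFirst (by omega))
  obtain ⟨i, rfl⟩ := Nat.exists_eq_add_of_le hn
  rw [show fesFirst {a, b, a + b} v + i +
    (fesFirst {a, b, a + b} w - fesFirst {a, b, a + b} v) = fesFirst {a, b, a + b} w + i by omega]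
  rcases lt_or_ge i (a + b) with hi | hi
  · simpa [code] using Finset.ext_iff.1 hcode ⟨i, hi⟩
  · refine iff_of_false (fun h => ?_) (fun h => ?_)
    all_goals
      have := lt_fesFirst_add_of_fesG_lt ha h
      omega

theorem exists_fesG_lt_iff (ha : 0 < a) (hab : a < b) (hb : b ≠ 2 * a) :
    ∃ p s, 0 < p ∧ 0 < s ∧ ∀ n, fesG {a, b, a + b} n < s ↔ n < p := by
  obtain ⟨v, d, h, hd, H⟩ := exists_fesShift (b := b) ha
  obtain ⟨H1, H2⟩ := H.sub ha hab hb
  have hiff (n : ℕ) : fesG {a, b, a + b} n < d ↔ n < h := by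
    refine ⟨fun hn => ?_, H2 n⟩
    by_contra! hle
    have := (H1 (n - h)).2 (by rwa [Nat.sub_add_cancel hle])
    omega
  refine ⟨h, d, ?_, hd, hiff⟩
  have h0 : fesG {a, b, a + b} 0 ≤ 0 := fesG_le (by simp)
  exact (hiff 0).1 (by omega)

end Sum

/-- Sleator–Slusky: all-but nim with a three-element FES set is purely
arithmetic periodic. -/
theorem sleator_slusky (a b c : ℕ) (ha : 0 < a) (hab : a < b) (hbc : b < c) :
    ∃ (p s : ℕ), 0 < p ∧ 0 < s ∧
      ∀ n : ℕ, fesG {a, b, c} (n + p) = fesG {a, b, c} n + s := by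
  suffices h : ∃ p s, 0 < p ∧ 0 < s ∧ ∀ n, fesG {a, b, c} n < s ↔ n < p by
    obtain ⟨p, s, hp, hs, h⟩ := h
    exact ⟨p, s, hp, hs, fesG_add_of_lt_iff h⟩
  by_cases hc : c = a + b ∧ b ≠ 2 * a
  · obtain ⟨rfl, hb⟩ := hc
    exact exists_fesG_lt_iff ha hab hb
  have key (k : ℕ) (hk : 0 < k) (hmul : ∀ i, 0 < i → i < k → i * a ∈ ({a, b, c} : Finset ℕ))
      (hprog : ∀ d, ∃ i < k, d - i * a ∉ ({a, b, c} : Finset ℕ)) :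
      ∃ p s, 0 < p ∧ 0 < s ∧ ∀ n, fesG {a, b, c} n < s ↔ n < p := by
    refine ⟨k * a, a, Nat.mul_pos hk ha, ha, fesG_lt_iff_lt_mul ha ?_ hmul hprog⟩
    intro m hm
    simp only [Finset.mem_insert, Finset.mem_singleton] at hm
    omega
  simp only [Finset.mem_insert, Finset.mem_singleton] at key
  by_cases h2 : b = 2 * a ∨ c = 2 * a
  · by_cases h3 : c = 3 * a
    · refine key 4 (by norm_num) (fun i h0 h4 => ?_) (fun d => ?_)
      · interval_cases i <;> omega
      · by_contra! h
        have := h 0; have := h 1; have := h 2; have := h 3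
        omega
    · refine key 3 (by norm_num) (fun i h0 h4 => ?_) (fun d => ?_)
      · interval_cases i <;> omega
      · by_contra! h
        have := h 0; have := h 1; have := h 2
        omega
  · refine key 2 (by norm_num) (fun i h0 h4 => ?_) (fun d => ?_)
    · interval_cases i; omega
    · by_contra! h
      have := h 0; have := h 1
      omega
end

section
/- (Abuku–Suetsugu, gcd reduction for all-but nim.) Let S = {a_1, …, a_r} be a finite nonempty set of positive integers, let g = gcd(a_1, …, a_r), and let S' = {a_1/g, …, a_r/g}. Then for every natural number n, the nim-values of all-but nim satisfy G_{ℕ∖S}(n) = g · G_{ℕ∖S'}(⌊n/g⌋) + (n mod g). -/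
theorem fesG_eq (S : Finset ℕ) (n : ℕ) :
    fesG S n = sInf {k : ℕ | ∀ m, 0 < m → m ≤ n → m ∉ S → fesG S (n - m) ≠ k} := by
  rw [fesG]

theorem fesG_ne_of_move (S : Finset ℕ) {n m : ℕ} (hm : 0 < m) (hn : m ≤ n) (hS : m ∉ S) :
    fesG S (n - m) ≠ fesG S n := by
  have hne : {k : ℕ | ∀ m, 0 < m → m ≤ n → m ∉ S → fesG S (n - m) ≠ k}.Nonempty := by
    obtain ⟨k, hk⟩ := Infinite.exists_notMem_finset ((Finset.range n).image (fesG S))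
    refine ⟨k, fun m hm hn _ h => hk ?_⟩
    exact Finset.mem_image.2 ⟨n - m, Finset.mem_range.2 (by omega), h⟩
  rw [fesG_eq S n]
  exact Nat.sInf_mem hne m hm hn hS

theorem exists_move_of_lt_fesG (S : Finset ℕ) {n k : ℕ} (hk : k < fesG S n) :
    ∃ m, 0 < m ∧ m ≤ n ∧ m ∉ S ∧ fesG S (n - m) = k := by
  rw [fesG_eq] at hk
  have h := Nat.notMem_of_lt_sInf hk
  simp only [Set.mem_ofPred_eq] at h
  push Not at h
  exact h

theorem fesG_eq_of_forall (S : Finset ℕ) {n k : ℕ}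
    (hne : ∀ m, 0 < m → m ≤ n → m ∉ S → fesG S (n - m) ≠ k)
    (hex : ∀ j < k, ∃ m, 0 < m ∧ m ≤ n ∧ m ∉ S ∧ fesG S (n - m) = j) :
    fesG S n = k := by
  rcases lt_trichotomy (fesG S n) k with h | h | h
  · obtain ⟨m, hm, hn, hS, he⟩ := hex _ h
    exact absurd he (fesG_ne_of_move S hm hn hS)
  · exact h
  · obtain ⟨m, hm, hn, hS, he⟩ := exists_move_of_lt_fesG S h
    exact absurd he (hne m hm hn hS)

/-- The reduction formula holds for every positive common divisor `g` of `S`. -/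
theorem fesG_eq_mul_add_mod (S : Finset ℕ) {g : ℕ} (hg : 0 < g) (hdvd : ∀ s ∈ S, g ∣ s) (n : ℕ) :
    fesG S n = g * fesG (S.image (fun a => a / g)) (n / g) + n % g := by
  have hmem : ∀ d, d ∈ S.image (fun a => a / g) ↔ g * d ∈ S := by
    intro d
    rw [Finset.mem_image]
    constructor
    · rintro ⟨a, ha, rfl⟩
      rwa [Nat.mul_div_cancel' (hdvd a ha)]
    · exact fun h => ⟨_, h, Nat.mul_div_cancel_left d hg⟩
  generalize S.image (fun a => a / g) = T at hmem ⊢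
  induction n using Nat.strong_induction_on with
  | _ n ih =>
  have ih' : ∀ q t, t < g → g * q + t < n → fesG S (g * q + t) = g * fesG T q + t := by
    intro q t ht hlt
    rw [ih _ hlt, Nat.mul_add_div hg, Nat.div_eq_of_lt ht, Nat.mul_add_mod,
      Nat.mod_eq_of_lt ht, add_zero]
  obtain ⟨q, r, hr, rfl⟩ : ∃ q r, r < g ∧ n = g * q + r :=
    ⟨n / g, n % g, Nat.mod_lt _ hg, (Nat.div_add_mod n g).symm⟩
  rw [Nat.mul_add_div hg, Nat.div_eq_of_lt hr, Nat.mul_add_mod, Nat.mod_eq_of_lt hr, add_zero]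
  have huniq : ∀ a b s t, s < g → t < g → g * a + s = g * b + t → a = b ∧ s = t := by
    intro a b s t hs ht h
    have hst : s = t := by
      simpa [Nat.mul_add_mod, Nat.mod_eq_of_lt hs, Nat.mod_eq_of_lt ht] using congrArg (· % g) h
    subst hst
    exact ⟨Nat.eq_of_mul_eq_mul_left hg (by omega), rfl⟩
  -- A move that changes the residue modulo `g` is never excluded.
  have hfree : ∀ p t, t < g → t ≠ r → g * p + t < g * q + r → g * q + r - (g * p + t) ∉ S := by
    intro p t ht htr hlt hS
    obtain ⟨c, hc⟩ := hdvd _ hS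
    have : g * q + r = g * (p + c) + t := by rw [mul_add]; omega
    exact htr (huniq _ _ _ _ hr ht this).2.symm
  apply fesG_eq_of_forall
  · intro m hm hn hS he
    obtain ⟨p, t, ht, hp⟩ : ∃ p t, t < g ∧ g * q + r - m = g * p + t :=
      ⟨_, _, Nat.mod_lt _ hg, (Nat.div_add_mod (g * q + r - m) g).symm⟩
    rw [hp, ih' p t ht (by omega)] at he
    obtain ⟨hG, rfl⟩ := huniq _ _ _ _ ht hr he
    have hpq : p < q := Nat.lt_of_mul_lt_mul_left (a := g) (by omega)
    refine fesG_ne_of_move T (n := q) (m := q - p) (by omega) (by omega) ?_ ?_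
    · have hmul : g * q - g * p = m := by omega
      rwa [hmem, Nat.mul_sub, hmul]
    · rwa [Nat.sub_sub_self hpq.le]
  · suffices H : ∀ j t, t < g → g * j + t < g * fesG T q + r →
        ∃ p, g * p + t < g * q + r ∧ g * q + r - (g * p + t) ∉ S ∧ fesG T p = j by
      intro v hv
      rw [← Nat.div_add_mod v g] at hv ⊢
      have ht := Nat.mod_lt v hg
      obtain ⟨p, hlt, hS, hG⟩ := H _ _ ht hv
      refine ⟨g * q + r - (g * p + v % g), by omega, by omega, hS, ?_⟩
      rw [Nat.sub_sub_self hlt.le, ih' p _ ht hlt, hG]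
    intro j t ht hlt
    rcases lt_trichotomy j (fesG T q) with hj | rfl | hj
    · obtain ⟨d, hd, hdq, hT, hG⟩ := exists_move_of_lt_fesG T hj
      have hle : g * (q - d + 1) ≤ g * q := Nat.mul_le_mul_left g (by omega)
      rw [mul_add, mul_one] at hle
      refine ⟨q - d, by omega, ?_, hG⟩
      by_cases htr : t = r
      · subst htr
        rw [hmem] at hT
        rwa [Nat.add_sub_add_right, ← Nat.mul_sub, Nat.sub_sub_self hdq]
      · exact hfree _ _ ht htr (by omega)
    · exact ⟨q, by omega, hfree q t ht (by omega) (by omega), rfl⟩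
    · have hle : g * (fesG T q + 1) ≤ g * j := Nat.mul_le_mul_left g hj
      rw [mul_add, mul_one] at hle
      omega

/-- Abuku–Suetsugu, gcd reduction: with `g = gcd S` and
`S' = {a / g : a ∈ S}`, we have `G_{ℕ∖S}(n) = g · G_{ℕ∖S'}(⌊n/g⌋) + (n mod g)`. -/
theorem abuku_suetsugu_gcd (S : Finset ℕ) (hne : S.Nonempty) (hpos : ∀ s ∈ S, 0 < s) :
    ∀ n : ℕ, fesG S n =
      S.gcd id * fesG (S.image (fun a => a / S.gcd id)) (n / S.gcd id) + n % S.gcd id := by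
  obtain ⟨s, hs⟩ := hne
  have hdvd : ∀ s ∈ S, S.gcd id ∣ s := fun s hs => Finset.gcd_dvd (f := id) hs
  exact fesG_eq_mul_add_mod S (Nat.pos_of_dvd_of_pos (hdvd s hs) (hpos s hs)) hdvd
end
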